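/- Let O ⊆ ℝ^d be an open set and let β, δ, ω be positive Borel measures on O with compact support in O such that β ⪯_{har(O)} δ (∫ h dβ = ∫ h dδ for all h harmonic on O) and β ⪯_{sbh(O)} ω (∫ u dβ ≤ ∫ u dω for all u subharmonic on O). Suppose there is an open set O′ relatively compact in O with infill_O(supp β ∪ supp δ) ⊆ O′ and O′ ∩ supp ω = ∅. Then δ ⪯_{sbh(O)} ω, i.e. ∫ u dδ ≤ ∫ u dω for every u subharmonic on O. -/

import Mathlib

open MeasureTheory Metric Set Filter
open scoped ENNReal Topology OnePoint

noncomputable section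

/-- `d`-dimensional Euclidean space. -/
abbrev Euc (d : ℕ) : Type := EuclideanSpace ℝ (Fin d)

/-- A real-valued function is *harmonic on a set* if it is continuous there and satisfies
the mean value equality over every closed ball contained in the set. -/
def HarmOn {d : ℕ} (h : Euc d → ℝ) (O : Set (Euc d)) : Prop :=
  ContinuousOn h O ∧
    ∀ x : Euc d, ∀ r : ℝ, 0 < r → closedBall x r ⊆ O →
      h x = ⨍ y in closedBall x r, h y ∂volume

/-- An `EReal`-valued function is *subharmonic on a set* if it is upper semicontinuous there,
nowhere `+∞` there, and on every closed ball contained in the set it is dominated by each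
continuous function harmonic in the interior that dominates it on the boundary sphere. -/
def SbhOn {d : ℕ} (u : Euc d → EReal) (O : Set (Euc d)) : Prop :=
  UpperSemicontinuousOn u O ∧ (∀ x ∈ O, u x < ⊤) ∧
    ∀ x : Euc d, ∀ r : ℝ, 0 < r → closedBall x r ⊆ O →
      ∀ h : Euc d → ℝ, ContinuousOn h (closedBall x r) → HarmOn h (ball x r) →
        (∀ y ∈ sphere x r, u y ≤ (h y : EReal)) →
        ∀ y ∈ closedBall x r, u y ≤ (h y : EReal)

/-- The positive part of an extended real number, as a member of `ℝ≥0∞`. -/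
def erealPos (x : EReal) : ℝ≥0∞ := if x = ⊤ then ⊤ else ENNReal.ofReal x.toReal

/-- The integral of an `EReal`-valued function against a measure, with values in `EReal`:
the lower integral of the positive part minus the lower integral of the negative part. -/
def eInt {d : ℕ} (μ : Measure (Euc d)) (u : Euc d → EReal) : EReal :=
  ((∫⁻ x, erealPos (u x) ∂μ : ℝ≥0∞) : EReal) -
    ((∫⁻ x, erealPos (-(u x)) ∂μ : ℝ≥0∞) : EReal)

/-- The (closed) support of a measure: points all of whose open neighbourhoods
have strictly positive measure. -/
def msupp {d : ℕ} (μ : Measure (Euc d)) : Set (Euc d) :=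
  {x | ∀ U : Set (Euc d), IsOpen U → x ∈ U → 0 < μ U}

/-- A finite positive Borel measure whose support is a compact subset of `O`. -/
def MeasCompIn {d : ℕ} (μ : Measure (Euc d)) (O : Set (Euc d)) : Prop :=
  IsCompact (msupp μ) ∧ msupp μ ⊆ O ∧ μ (msupp μ)ᶜ = 0 ∧ μ Set.univ < ⊤

/-- The *inward filling* of `S` with respect to `O`: the union of `S` with all connected
components of `O \ S` that are relatively compact in `O`. -/
def infill {X : Type*} [TopologicalSpace X] (O S : Set X) : Set X :=
  S ∪ {y | ∃ x ∈ O \ S, y ∈ connectedComponentIn (O \ S) x ∧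
      IsCompact (closure (connectedComponentIn (O \ S) x)) ∧
      closure (connectedComponentIn (O \ S) x) ⊆ O}

section BallAverages

variable {d : ℕ}

lemma eq_setAverage_closedBall_iff {f : Euc d → ℝ} {x : Euc d} {r : ℝ} (hr : 0 < r) {c : ℝ} :
    c = ⨍ y in closedBall x r, f y ∂volume ↔
      ∫ y in closedBall x r, f y = volume.real (closedBall x r) * c := by
  have hv : 0 < volume.real (closedBall x r) :=
    ENNReal.toReal_pos (measure_closedBall_pos volume x hr).ne' measure_closedBall_lt_top.ne
  rw [setAverage_eq, smul_eq_mul, eq_inv_mul_iff_mul_eq₀ hv.ne']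
  exact eq_comm

lemma le_setAverage_closedBall_iff {f : Euc d → ℝ} {x : Euc d} {r : ℝ} (hr : 0 < r) {c : ℝ} :
    c ≤ ⨍ y in closedBall x r, f y ∂volume ↔
      volume.real (closedBall x r) * c ≤ ∫ y in closedBall x r, f y := by
  have hv : 0 < volume.real (closedBall x r) :=
    ENNReal.toReal_pos (measure_closedBall_pos volume x hr).ne' measure_closedBall_lt_top.ne
  rw [setAverage_eq, smul_eq_mul, le_inv_mul_iff₀ hv]

lemma ContinuousOn.integrableOn_closedBall {f : Euc d → ℝ} {O : Set (Euc d)}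
    (hf : ContinuousOn f O) {x : Euc d} {r : ℝ} (h : closedBall x r ⊆ O) :
    IntegrableOn f (closedBall x r) :=
  (hf.mono h).integrableOn_compact (isCompact_closedBall x r)

lemma HarmOn.mono {h : Euc d → ℝ} {U O : Set (Euc d)} (hh : HarmOn h O) (hU : U ⊆ O) :
    HarmOn h U :=
  ⟨hh.1.mono hU, fun x r hr hx => hh.2 x r hr (hx.trans hU)⟩

lemma HarmOn.congr {h g : Euc d → ℝ} {O : Set (Euc d)} (hh : HarmOn h O) (hg : EqOn g h O) :
    HarmOn g O := by
  refine ⟨hh.1.congr hg, fun x r hr hx => ?_⟩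
  rw [hg (hx (mem_closedBall_self hr.le)), hh.2 x r hr hx, setAverage_eq, setAverage_eq]
  congr 1
  exact (setIntegral_congr_fun measurableSet_closedBall fun y hy => hg (hx hy)).symm

lemma HarmOn.add {h g : Euc d → ℝ} {O : Set (Euc d)} (hh : HarmOn h O) (hg : HarmOn g O) :
    HarmOn (fun x => h x + g x) O := by
  refine ⟨hh.1.add hg.1, fun x r hr hx => ?_⟩
  have h1 := (eq_setAverage_closedBall_iff hr).1 (hh.2 x r hr hx)
  have h2 := (eq_setAverage_closedBall_iff hr).1 (hg.2 x r hr hx)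
  rw [eq_setAverage_closedBall_iff hr,
    integral_add (hh.1.integrableOn_closedBall hx) (hg.1.integrableOn_closedBall hx), h1, h2]
  ring

lemma HarmOn.const_mul {h : Euc d → ℝ} {O : Set (Euc d)} (hh : HarmOn h O) (c : ℝ) :
    HarmOn (fun x => c * h x) O := by
  refine ⟨continuousOn_const.mul hh.1, fun x r hr hx => ?_⟩
  have h1 := (eq_setAverage_closedBall_iff hr).1 (hh.2 x r hr hx)
  rw [eq_setAverage_closedBall_iff hr, integral_const_mul, h1]
  ring

lemma harmOn_const (c : ℝ) (O : Set (Euc d)) : HarmOn (fun _ => c) O := by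
  refine ⟨continuousOn_const, fun x r hr hx => ?_⟩
  rw [eq_setAverage_closedBall_iff hr]
  simp

lemma HarmOn.neg {h : Euc d → ℝ} {O : Set (Euc d)} (hh : HarmOn h O) :
    HarmOn (fun x => -h x) O := by
  simpa using hh.const_mul (-1)

lemma HarmOn.sub {h g : Euc d → ℝ} {O : Set (Euc d)} (hh : HarmOn h O) (hg : HarmOn g O) :
    HarmOn (fun x => h x - g x) O := by
  simpa [sub_eq_add_neg] using hh.add hg.neg

lemma setIntegral_closedBall_comp_add (f : Euc d → ℝ) (x z : Euc d) (r : ℝ) :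
    ∫ y in closedBall x r, f (y + z) = ∫ y in closedBall (x + z) r, f y := by
  have h := (measurePreserving_add_right (volume : Measure (Euc d)) z).setIntegral_preimage_emb
    (measurableEmbedding_addRight z) f (closedBall (x + z) r)
  rw [← h]
  congr 2
  ext y
  simp

lemma HarmOn.comp_add {h : Euc d → ℝ} {O U : Set (Euc d)} (hh : HarmOn h O) (z : Euc d)
    (hU : ∀ x ∈ U, x + z ∈ O) : HarmOn (fun x => h (x + z)) U := by
  refine ⟨hh.1.comp (by fun_prop) hU, fun x r hr hx => ?_⟩
  rw [eq_setAverage_closedBall_iff hr, setIntegral_closedBall_comp_add]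
  have hx' : closedBall (x + z) r ⊆ O := by
    intro y hy
    have := hU (y - z) (hx (by simpa [mem_closedBall, dist_eq_norm, sub_sub, add_comm] using hy))
    simpa using this
  rw [(eq_setAverage_closedBall_iff hr).1 (hh.2 (x + z) r hr hx')]
  rw [Measure.real, Measure.real, Measure.addHaar_closedBall_center,
    Measure.addHaar_closedBall_center volume x]

/-- Maximum principle for upper semicontinuous functions satisfying a local sub-mean value
property in a bounded open set. -/
theorem nonpos_of_le_setAverage (hd : 0 < d) {U : Set (Euc d)} (hU : IsOpen U)
    (hUb : Bornology.IsBounded U) {w : Euc d → ℝ} (hw : UpperSemicontinuousOn w (closure U))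
    (hm : ∀ x ∈ U, ∃ r > 0, closedBall x r ⊆ U ∧ IntegrableOn w (closedBall x r) ∧
      w x ≤ ⨍ y in closedBall x r, w y ∂volume)
    (hb : ∀ x ∈ closure U, x ∉ U → w x ≤ 0) : ∀ x ∈ closure U, w x ≤ 0 := by
  have hK : IsCompact (closure U) := hUb.isCompact_closure
  intro x₀ hx₀
  by_contra! hpos
  obtain ⟨m, hmU, hmax⟩ := hw.exists_isMaxOn ⟨x₀, hx₀⟩ hK
  have hM : 0 < w m := hpos.trans_le (hmax hx₀)
  set A : Set (Euc d) := {x ∈ closure U | w m ≤ w x} with hA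
  have hAc : IsCompact A := by
    have : IsClosed A := by
      rw [← isOpen_compl_iff]
      obtain ⟨V, hV, hVe⟩ := (upperSemicontinuousOn_iff_preimage_Iio.1 hw) (w m)
      have : Aᶜ = (closure U)ᶜ ∪ V := by
        ext x
        have h1 : x ∈ closure U ∩ w ⁻¹' Iio (w m) ↔ x ∈ closure U ∩ V := by rw [hVe]
        simp only [mem_inter_iff, mem_preimage, mem_Iio] at h1
        simp only [hA, mem_compl_iff, mem_ofPred_eq, not_and, not_le, mem_union]
        tauto
      rw [this]
      exact isClosed_closure.isOpen_compl.union hV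
    exact hK.of_isClosed_subset this fun x hx => hx.1
  obtain ⟨p, hpA, hpmax⟩ := hAc.exists_isMaxOn ⟨m, hmU, le_rfl⟩ continuous_norm.continuousOn
  have hpU : p ∈ U := by
    by_contra h
    exact absurd (hb p hpA.1 h) (not_le.2 (hM.trans_le hpA.2))
  obtain ⟨r, hr, hrU, hint, hle⟩ := hm p hpU
  obtain ⟨q, hq, hqn⟩ : ∃ q ∈ ball p r, ‖p‖ < ‖q‖ := by
    by_cases hp : p = 0
    · have : Nonempty (Fin d) := ⟨⟨0, hd⟩⟩
      obtain ⟨v, hv⟩ := exists_norm_eq (Euc d) (half_pos hr).le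
      refine ⟨v, ?_, ?_⟩
      · simp [hp, hv, hr]
      · simp [hp, hv, hr]
    · have hp' : 0 < ‖p‖ := norm_pos_iff.2 hp
      refine ⟨p + (r / 2 / ‖p‖) • p, ?_, ?_⟩
      · simp only [mem_ball, dist_self_add_left, norm_smul, norm_div, Real.norm_eq_abs, abs_norm]
        rw [div_mul_cancel₀ _ hp'.ne', abs_of_pos hr]
        simp [hr]
      · have : p + (r / 2 / ‖p‖) • p = (1 + r / 2 / ‖p‖) • p := by rw [add_smul, one_smul]
        rw [this, norm_smul, Real.norm_of_nonneg (by positivity)]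
        have : 0 < r / 2 / ‖p‖ := by positivity
        nlinarith
  have hqU : q ∈ U := hrU (ball_subset_closedBall hq)
  have hqlt : w q < w m := by
    by_contra! h
    exact absurd (hpmax (show q ∈ A from ⟨subset_closure hqU, h⟩)) (not_le.2 hqn)
  have hnn : ∀ y ∈ closedBall p r, 0 ≤ w m - w y := fun y hy =>
    sub_nonneg.2 (hmax (subset_closure (hrU hy)))
  have hint' : IntegrableOn (fun y => w m - w y) (closedBall p r) :=
    (integrableOn_const measure_closedBall_lt_top.ne).sub hint
  have hnear : ∀ᶠ y in 𝓝 q, y ∈ closedBall p r ∧ w y < w m := by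
    have h1 := hw q (subset_closure hqU) (w m) hqlt
    rw [nhdsWithin_eq_nhds.2 (Filter.mem_of_superset (hU.mem_nhds hqU) subset_closure)] at h1
    filter_upwards [isOpen_ball.mem_nhds hq, h1] with y hy hy'
    exact ⟨ball_subset_closedBall hy, hy'⟩
  have hsupp : 0 < volume ((Function.support fun y => w m - w y) ∩ closedBall p r) := by
    obtain ⟨V, hV, hVo, hqV⟩ := _root_.eventually_nhds_iff.1 hnear
    refine (hVo.measure_pos volume ⟨q, hqV⟩).trans_le (measure_mono fun y hy => ⟨?_, (hV y hy).1⟩)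
    exact (sub_pos.2 (hV y hy).2).ne'
  have hlt : 0 < ∫ y in closedBall p r, (w m - w y) := by
    rw [setIntegral_pos_iff_support_of_nonneg_ae _ hint']
    · exact hsupp
    · exact (ae_restrict_iff' measurableSet_closedBall).2 (ae_of_all _ hnn)
  rw [le_setAverage_closedBall_iff hr] at hle
  rw [integral_sub ((integrableOn_const (μ := volume) measure_closedBall_lt_top.ne).integrable)
    hint] at hlt
  simp only [integral_const, smul_eq_mul, measureReal_restrict_apply_univ] at hlt
  have := mul_le_mul_of_nonneg_left hpA.2 (measureReal_nonneg (μ := volume) (s := closedBall p r))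
  linarith

end BallAverages

section SmoothMeanValue

variable {d : ℕ}

/-- The Laplacian as the sum of the pure second partial derivatives. -/
def coordLaplacian (f : Euc d → ℝ) (x : Euc d) : ℝ :=
  ∑ i : Fin d, fderiv ℝ (fun y => fderiv ℝ f y (EuclideanSpace.single i (1 : ℝ))) x
    (EuclideanSpace.single i (1 : ℝ))

lemma coordLaplacian_congr {f g : Euc d → ℝ} {x : Euc d} (h : f =ᶠ[𝓝 x] g) :
    coordLaplacian f x = coordLaplacian g x := by
  unfold coordLaplacian
  refine Finset.sum_congr rfl fun i _ => ?_
  have : (fun y => fderiv ℝ f y (EuclideanSpace.single i (1 : ℝ))) =ᶠ[𝓝 x]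
      fun y => fderiv ℝ g y (EuclideanSpace.single i (1 : ℝ)) := by
    filter_upwards [h.fderiv (𝕜 := ℝ)] with y hy
    rw [hy]
  rw [this.fderiv_eq]

/-- A Lipschitz function vanishing off the unit ball whose gradient at `y` in the ball is `-y`. -/
def unitWell (y : Euc d) : ℝ := (1 - (min ‖y‖ 1) ^ 2) / 2

lemma lipschitzWith_unitWell : LipschitzWith 1 (unitWell : Euc d → ℝ) := by
  refine LipschitzWith.of_dist_le_mul fun y z => ?_
  have h1 : |min ‖y‖ 1 - min ‖z‖ 1| ≤ ‖y - z‖ :=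
    (abs_inf_sub_inf_le_abs _ _ _).trans (abs_norm_sub_norm_le y z)
  have hy0 : 0 ≤ min ‖y‖ 1 := le_min (norm_nonneg _) zero_le_one
  have hz0 : 0 ≤ min ‖z‖ 1 := le_min (norm_nonneg _) zero_le_one
  have hy1 : min ‖y‖ 1 ≤ 1 := min_le_right _ _
  have hz1 : min ‖z‖ 1 ≤ 1 := min_le_right _ _
  rw [NNReal.coe_one, one_mul, dist_eq_norm, dist_eq_norm, Real.norm_eq_abs]
  have : unitWell y - unitWell z =
      -((min ‖y‖ 1 - min ‖z‖ 1) * ((min ‖y‖ 1 + min ‖z‖ 1) / 2)) := by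
    unfold unitWell; ring
  rw [this, abs_neg, abs_mul, abs_of_nonneg (a := (min ‖y‖ 1 + min ‖z‖ 1) / 2) (by positivity)]
  calc _ ≤ |min ‖y‖ 1 - min ‖z‖ 1| * 1 := by gcongr; linarith
    _ ≤ _ := by rw [mul_one]; exact h1

lemma unitWell_nonneg (y : Euc d) : 0 ≤ unitWell y := by
  have hy0 : 0 ≤ min ‖y‖ 1 := le_min (norm_nonneg _) zero_le_one
  have hy1 : min ‖y‖ 1 ≤ 1 := min_le_right _ _
  unfold unitWell
  nlinarith

lemma unitWell_of_one_le {y : Euc d} (hy : 1 ≤ ‖y‖) : unitWell y = 0 := by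
  simp [unitWell, min_eq_right hy]

lemma hasCompactSupport_unitWell : HasCompactSupport (unitWell : Euc d → ℝ) := by
  refine HasCompactSupport.intro (isCompact_closedBall 0 1) fun y hy => unitWell_of_one_le ?_
  simp only [mem_closedBall, dist_zero_right, not_le] at hy
  exact hy.le

lemma lineDeriv_unitWell_ae (i : Fin d) :
    (fun y : Euc d => lineDeriv ℝ unitWell y (-EuclideanSpace.single i 1)) =ᵐ[volume]
      (closedBall 0 1).indicator fun y => y i := by
  have hs : ∀ᵐ y : Euc d, y ∉ sphere (0 : Euc d) 1 :=
    measure_eq_zero_iff_ae_notMem.1 (Measure.addHaar_sphere_of_ne_zero volume _ one_ne_zero)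
  filter_upwards [hs] with y hy
  simp only [mem_sphere, dist_zero_right] at hy
  rcases lt_or_gt_of_ne hy with h | h
  · rw [indicator_of_mem (by simpa using h.le)]
    have he : unitWell =ᶠ[𝓝 y] fun z : Euc d => (1 - ‖z‖ ^ 2) / 2 := by
      filter_upwards [(continuous_norm.tendsto y).eventually_lt_const h] with z hz
      simp [unitWell, min_eq_left hz.le]
    have hd : HasFDerivAt (fun z : Euc d => (1 - ‖z‖ ^ 2) / 2) (-innerSL ℝ y) y := by
      simp only [div_eq_mul_inv]
      refine HasFDerivAt.congr_fderiv
        (((hasStrictFDerivAt_norm_sq y).hasFDerivAt.const_sub 1).mul_const (2 : ℝ)⁻¹) ?_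
      ext z
      simp
    rw [he.lineDeriv_eq, (hd.hasLineDerivAt _).lineDeriv]
    simp [EuclideanSpace.inner_single_right]
  · rw [indicator_of_notMem (by simpa using h)]
    have he : unitWell =ᶠ[𝓝 y] fun _ : Euc d => (0 : ℝ) := by
      filter_upwards [(continuous_norm.tendsto y).eventually_const_lt h] with z hz
      exact unitWell_of_one_le hz.le
    rw [he.lineDeriv_eq]
    simp [lineDeriv]

lemma setIntegral_closedBall_eq_unit (f : Euc d → ℝ) (x : Euc d) {r : ℝ} (hr : 0 < r) :
    ∫ y in closedBall x r, f y = r ^ d * ∫ y in closedBall (0 : Euc d) 1, f (x + r • y) := by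
  have h := Measure.setIntegral_comp_smul (volume : Measure (Euc d)) (fun y => f (y + x))
    (closedBall 0 1) hr.ne'
  rw [smul_unitClosedBall_of_nonneg hr.le, setIntegral_closedBall_comp_add, zero_add] at h
  simp only [add_comm x]
  rw [h, finrank_euclideanSpace_fin, smul_eq_mul, abs_of_pos (by positivity), ← mul_assoc,
    mul_inv_cancel₀ (by positivity), one_mul]

lemma volume_real_closedBall_eq_unit (x : Euc d) {r : ℝ} (hr : 0 < r) :
    volume.real (closedBall x r) = r ^ d * volume.real (closedBall (0 : Euc d) 1) := by
  have := setIntegral_closedBall_eq_unit (fun _ => 1) x hr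
  simpa using this

lemma le_setAverage_of_hasCompactSupport {f : Euc d → ℝ} (hf : ContDiff ℝ 2 f)
    (hfc : HasCompactSupport f) {x : Euc d} {r : ℝ} (hr : 0 < r)
    (hlap : ∀ y ∈ closedBall x r, 0 ≤ coordLaplacian f y) :
    f x ≤ ⨍ y in closedBall x r, f y ∂volume := by
  set e : Fin d → Euc d := fun i => EuclideanSpace.single i 1 with he
  set B : Set (Euc d) := closedBall 0 1 with hB
  set p : Fin d → Euc d → ℝ := fun i z => fderiv ℝ f z (e i) with hp
  have hf1 : ContDiff ℝ 1 (fderiv ℝ f) := hf.fderiv_right (by norm_num)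
  have hp1 : ∀ i, ContDiff ℝ 1 (p i) := fun i => hf1.clm_apply contDiff_const
  have hpc : ∀ i, HasCompactSupport (p i) := fun i =>
    hfc.fderiv_apply (𝕜 := ℝ) (e i)
  obtain ⟨C, hC⟩ := (hf1.continuous.bounded_above_of_compact_support (hfc.fderiv (𝕜 := ℝ)))
  set M : ℝ → ℝ := fun s => ∫ y in B, f (x + s • y) with hM
  have hder : ∀ s, HasDerivAt M (∫ y in B, fderiv ℝ f (x + s • y) y) s := by
    intro s
    refine (hasDerivAt_integral_of_dominated_loc_of_deriv_le (𝕜 := ℝ) (μ := volume.restrict B)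
      (F := fun s y => f (x + s • y)) (F' := fun s y => fderiv ℝ f (x + s • y) y) (x₀ := s)
      (s := univ) (bound := fun _ => C) univ_mem ?_ ?_ ?_ ?_ ?_ ?_).2
    · exact Eventually.of_forall fun s => (by fun_prop : Continuous fun y => f (x + s • y)).aestronglyMeasurable
    · exact (by fun_prop : Continuous fun y => f (x + s • y)).continuousOn.integrableOn_compact
        (isCompact_closedBall _ _)
    · have := hf1.continuous
      exact (by fun_prop : Continuous fun y => fderiv ℝ f (x + s • y) y).aestronglyMeasurable
    · refine (ae_restrict_iff' measurableSet_closedBall).2 (ae_of_all _ fun y hy t _ => ?_)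
      have hy1 : ‖y‖ ≤ 1 := by simpa using hy
      calc _ ≤ ‖fderiv ℝ f (x + t • y)‖ * ‖y‖ := ContinuousLinearMap.le_opNorm _ _
        _ ≤ C * 1 := mul_le_mul (hC _) hy1 (norm_nonneg _) ((norm_nonneg _).trans (hC x))
        _ = C := mul_one _
    · exact integrableOn_const measure_closedBall_lt_top.ne
    · refine ae_of_all _ fun y t _ => ?_
      have h1 : HasFDerivAt f (fderiv ℝ f (x + t • y)) (x + t • y) :=
        (hf.differentiable (by norm_num) _).hasFDerivAt
      have h2 : HasDerivAt (fun t : ℝ => x + t • y) y t := by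
        simpa using ((hasDerivAt_id t).smul_const y).const_add x
      exact h1.comp_hasDerivAt t h2
  have hparts : ∀ s, 0 < s → ∀ i, ∫ y in B, y i * p i (x + s • y) =
      s * ∫ y, fderiv ℝ (p i) (x + s • y) (e i) * unitWell y := by
    intro s hs i
    obtain ⟨D, hD⟩ := (hp1 i).lipschitzWith_of_hasCompactSupport (hpc i) (by norm_num)
    have hL : LipschitzWith (D * (Real.toNNReal s)) fun y => p i (x + s • y) := by
      refine hD.comp (LipschitzWith.of_dist_le_mul fun y z => ?_)
      rw [dist_add_left, dist_smul₀, Real.coe_toNNReal _ hs.le, Real.norm_of_nonneg hs.le]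
    have key := hL.integral_lineDeriv_mul_eq (μ := volume) lipschitzWith_unitWell
      hasCompactSupport_unitWell (e i)
    have h1 : ∀ y, lineDeriv ℝ (fun y => p i (x + s • y)) y (e i) =
        s * fderiv ℝ (p i) (x + s • y) (e i) := by
      intro y
      have h2 : HasFDerivAt (fun y : Euc d => x + s • y)
          (s • ContinuousLinearMap.id ℝ (Euc d)) y := by
        simpa using ((hasFDerivAt_id y).const_smul s).const_add x
      have h3 := (((hp1 i).differentiable (by norm_num)) (x + s • y)).hasFDerivAt.comp y h2
      rw [show (fun y => p i (x + s • y)) = p i ∘ fun y => x + s • y from rfl,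
        (h3.hasLineDerivAt _).lineDeriv]
      simp
    have h4 : ∫ y, lineDeriv ℝ unitWell y (-e i) * p i (x + s • y) =
        ∫ y in B, y i * p i (x + s • y) := by
      rw [← integral_indicator measurableSet_closedBall]
      refine integral_congr_ae ?_
      filter_upwards [lineDeriv_unitWell_ae i] with y hy
      simp only [he] at hy ⊢
      rw [hy]
      by_cases h : y ∈ closedBall (0 : Euc d) 1 <;> simp [h]
    rw [← h4, ← key, ← integral_const_mul]
    simp only [h1, mul_assoc]
  have hder' : ∀ s, 0 < s → ∫ y in B, fderiv ℝ f (x + s • y) y =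
      s * ∫ y, coordLaplacian f (x + s • y) * unitWell y := by
    intro s hs
    have h1 : ∀ y : Euc d, fderiv ℝ f (x + s • y) y = ∑ i, y i * p i (x + s • y) := by
      intro y
      have : y = ∑ i, y i • e i := by
        have := (EuclideanSpace.basisFun (Fin d) ℝ).sum_repr y
        simpa [he] using this.symm
      conv_lhs => rw [this]
      rw [map_sum]
      simp [hp, ← this]
    have hpc0 := fun i => (hp1 i).continuous
    simp_rw [h1]
    rw [integral_finsetSum]
    · simp_rw [hparts s hs]
      rw [← Finset.mul_sum, ← integral_finsetSum]
      · congr 2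
        ext y
        simp only [coordLaplacian, Finset.sum_mul, hp, he]
      · intro i _
        have h5 : Continuous (fderiv ℝ (p i)) := (hp1 i).continuous_fderiv (by norm_num)
        have h6 : Continuous (unitWell : Euc d → ℝ) := lipschitzWith_unitWell.continuous
        exact Continuous.integrable_of_hasCompactSupport (by fun_prop)
          hasCompactSupport_unitWell.mul_left
    · intro i _
      have := hpc0 i
      exact (by fun_prop : Continuous fun y : Euc d => y i * p i (x + s • y)).continuousOn.integrableOn_compact
        (isCompact_closedBall _ _)
  have hmono : MonotoneOn M (Icc 0 r) := by
    refine monotoneOn_of_deriv_nonneg (convex_Icc 0 r)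
      (fun s _ => (hder s).continuousAt.continuousWithinAt)
      (fun s _ => (hder s).differentiableAt.differentiableWithinAt) fun s hs => ?_
    rw [interior_Icc] at hs
    rw [(hder s).deriv, hder' s hs.1]
    refine mul_nonneg hs.1.le (integral_nonneg fun y => ?_)
    by_cases hy : ‖y‖ ≤ 1
    · refine mul_nonneg (hlap _ ?_) (unitWell_nonneg y)
      simp only [mem_closedBall, dist_self_add_left, norm_smul, Real.norm_of_nonneg hs.1.le]
      nlinarith [hs.2, hs.1, norm_nonneg y]
    · simp [unitWell_of_one_le (not_le.1 hy).le]
  have h0r := hmono (left_mem_Icc.2 hr.le) (right_mem_Icc.2 hr.le) hr.le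
  rw [le_setAverage_closedBall_iff hr, setIntegral_closedBall_eq_unit f x hr,
    volume_real_closedBall_eq_unit x hr, mul_assoc]
  refine mul_le_mul_of_nonneg_left ?_ (by positivity)
  simpa [hM, hB] using h0r

/-- Sub-mean value property of `C²` functions with nonnegative Laplacian on a ball. -/
theorem le_setAverage_of_coordLaplacian_nonneg {f : Euc d → ℝ} (hf : ContDiff ℝ 2 f)
    {x : Euc d} {r : ℝ} (hr : 0 < r) (hlap : ∀ y ∈ closedBall x r, 0 ≤ coordLaplacian f y) :
    f x ≤ ⨍ y in closedBall x r, f y ∂volume := by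
  let χ : ContDiffBump x := ⟨r + 1, r + 2, by linarith, by linarith⟩
  have hχ : ∀ y ∈ closedBall x r, (fun y => χ y * f y) =ᶠ[𝓝 y] f := by
    intro y hy
    filter_upwards [isOpen_ball.mem_nhds (show y ∈ ball x (r + 1) from
      closedBall_subset_ball (by linarith) hy)] with z hz
    have : χ z = 1 := χ.one_of_mem_closedBall (ball_subset_closedBall hz)
    simp [this]
  have h := le_setAverage_of_hasCompactSupport (f := fun y => χ y * f y) (χ.contDiff.mul hf)
    χ.hasCompactSupport.mul_right hr (fun y hy => by
      rw [coordLaplacian_congr (hχ y hy)]; exact hlap y hy)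
  rw [setAverage_eq] at h ⊢
  rw [setIntegral_congr_fun measurableSet_closedBall fun y hy => (hχ y hy).eq_of_nhds] at h
  rwa [(hχ x (mem_closedBall_self hr.le)).eq_of_nhds] at h

lemma coordLaplacian_neg (f : Euc d → ℝ) (x : Euc d) :
    coordLaplacian (fun y => -f y) x = -coordLaplacian f x := by
  simp [coordLaplacian, fderiv_fun_neg]

/-- Mean value property of `C²` functions with vanishing Laplacian on a ball. -/
theorem eq_setAverage_of_coordLaplacian_eq_zero {f : Euc d → ℝ} (hf : ContDiff ℝ 2 f)
    {x : Euc d} {r : ℝ} (hr : 0 < r) (hlap : ∀ y ∈ closedBall x r, coordLaplacian f y = 0) :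
    f x = ⨍ y in closedBall x r, f y ∂volume := by
  refine le_antisymm (le_setAverage_of_coordLaplacian_nonneg hf hr fun y hy => (hlap y hy).ge) ?_
  have h := le_setAverage_of_coordLaplacian_nonneg (f := fun y => -f y) hf.neg hr fun y hy => by
    rw [coordLaplacian_neg, hlap y hy, neg_zero]
  rw [setAverage_eq, integral_neg, smul_neg, ← setAverage_eq] at h
  linarith

end SmoothMeanValue

section MaximumPrinciple

variable {d : ℕ}

/-- Maximum principle for harmonic functions with upper semicontinuous extension to the closure. -/
lemma HarmOn.nonpos_of_boundary (hd : 0 < d) {U : Set (Euc d)} (hU : IsOpen U)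
    (hUb : Bornology.IsBounded U) {w : Euc d → ℝ} (hw : UpperSemicontinuousOn w (closure U))
    (hh : HarmOn w U) (hb : ∀ x ∈ closure U, x ∉ U → w x ≤ 0) : ∀ x ∈ closure U, w x ≤ 0 := by
  refine nonpos_of_le_setAverage hd hU hUb hw (fun x hx => ?_) hb
  obtain ⟨r, hr, hrU⟩ := Metric.nhds_basis_closedBall.mem_iff.1 (hU.mem_nhds hx)
  exact ⟨r, hr, hrU, hh.1.integrableOn_closedBall hrU, (hh.2 x r hr hrU).le⟩

lemma HarmOn.nonpos_on_closedBall (hd : 0 < d) {c : Euc d} {r : ℝ} (hr : 0 < r) {w : Euc d → ℝ}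
    (hw : ContinuousOn w (closedBall c r)) (hh : HarmOn w (ball c r))
    (hb : ∀ x ∈ sphere c r, w x ≤ 0) : ∀ x ∈ closedBall c r, w x ≤ 0 := by
  have hcl : closure (ball c r) = closedBall c r := closure_ball c hr.ne'
  rw [← hcl] at hw ⊢
  refine hh.nonpos_of_boundary hd isOpen_ball isBounded_ball hw.upperSemicontinuousOn
    fun x hx hx' => hb x ?_
  rw [hcl] at hx
  exact le_antisymm hx (not_lt.1 hx')

lemma HarmOn.le_on_closedBall (hd : 0 < d) {c : Euc d} {r : ℝ} (hr : 0 < r) {f g : Euc d → ℝ}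
    (hf : ContinuousOn f (closedBall c r)) (hfh : HarmOn f (ball c r))
    (hg : ContinuousOn g (closedBall c r)) (hgh : HarmOn g (ball c r))
    (hb : ∀ x ∈ sphere c r, f x ≤ g x) : ∀ x ∈ closedBall c r, f x ≤ g x := fun x hx =>
  sub_nonpos.1 ((hfh.sub hgh).nonpos_on_closedBall hd hr (hf.sub hg)
    (fun y hy => sub_nonpos.2 (hb y hy)) x hx)

end MaximumPrinciple

section PolynomialDirichlet

variable {d : ℕ}

/-- The function on Euclidean space defined by a polynomial. -/
def polyFun (p : MvPolynomial (Fin d) ℝ) (x : Euc d) : ℝ := MvPolynomial.eval (fun i => x i) p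

/-- The Laplacian of a polynomial. -/
def polyLaplacian : MvPolynomial (Fin d) ℝ →ₗ[ℝ] MvPolynomial (Fin d) ℝ :=
  ∑ i, (MvPolynomial.pderiv i).toLinearMap ∘ₗ (MvPolynomial.pderiv i).toLinearMap

lemma polyLaplacian_apply (p : MvPolynomial (Fin d) ℝ) :
    polyLaplacian p = ∑ i, MvPolynomial.pderiv i (MvPolynomial.pderiv i p) := by
  simp [polyLaplacian]

lemma contDiff_polyFun (p : MvPolynomial (Fin d) ℝ) {n : WithTop ℕ∞} :
    ContDiff ℝ n (polyFun p) := by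
  induction p using MvPolynomial.induction_on with
  | C a =>
    have : polyFun (MvPolynomial.C a : MvPolynomial (Fin d) ℝ) = fun _ => a := by
      ext; simp [polyFun]
    rw [this]
    exact contDiff_const
  | add p q hp hq =>
    have : polyFun (p + q) = fun x => polyFun p x + polyFun q x := by ext; simp [polyFun]
    rw [this]
    exact hp.add hq
  | mul_X p i hp =>
    have : polyFun (p * MvPolynomial.X i) = fun x => polyFun p x * x i := by
      ext; simp [polyFun]
    rw [this]
    have hX : ContDiff ℝ n fun x : Euc d => x i := by fun_prop
    exact hp.mul hX

lemma fderiv_polyFun (p : MvPolynomial (Fin d) ℝ) (x : Euc d) (i : Fin d) :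
    fderiv ℝ (polyFun p) x (EuclideanSpace.single i (1 : ℝ)) =
      polyFun (MvPolynomial.pderiv i p) x := by
  have hdiff : ∀ p : MvPolynomial (Fin d) ℝ, DifferentiableAt ℝ (polyFun p) x := fun p =>
    (contDiff_polyFun p (n := 1)).differentiable (by norm_num) x
  induction p using MvPolynomial.induction_on with
  | C a =>
    have : polyFun (MvPolynomial.C a : MvPolynomial (Fin d) ℝ) = fun _ => a := by
      ext; simp [polyFun]
    rw [this]
    simp [polyFun]
  | add p q hp hq =>
    have : polyFun (p + q) = polyFun p + polyFun q := by ext; simp [polyFun]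
    rw [this, fderiv_add (hdiff p) (hdiff q)]
    simp [hp, hq, polyFun]
  | mul_X p j hp =>
    have h1 : polyFun (p * MvPolynomial.X j) = fun x => polyFun p x * x j := by
      ext; simp [polyFun]
    have h2 : HasFDerivAt (fun x : Euc d => x j) (EuclideanSpace.proj j : Euc d →L[ℝ] ℝ) x :=
      (EuclideanSpace.proj j : Euc d →L[ℝ] ℝ).hasFDerivAt
    rw [h1, ((hdiff p).hasFDerivAt.fun_mul h2).fderiv]
    simp only [add_apply, smul_apply, hp,
      Derivation.leibniz, MvPolynomial.pderiv_X, smul_eq_mul]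
    by_cases hij : i = j
    · subst hij
      simp [polyFun]
    · simp [polyFun, Ne.symm hij]

lemma coordLaplacian_polyFun (p : MvPolynomial (Fin d) ℝ) (x : Euc d) :
    coordLaplacian (polyFun p) x = polyFun (polyLaplacian p) x := by
  simp only [coordLaplacian, fderiv_polyFun, polyLaplacian_apply]
  simp [polyFun]

lemma harmOn_polyFun {p : MvPolynomial (Fin d) ℝ} (hp : polyLaplacian p = 0) :
    HarmOn (polyFun p) univ := by
  refine ⟨(contDiff_polyFun p (n := 0)).continuous.continuousOn, fun x r hr _ => ?_⟩
  refine eq_setAverage_of_coordLaplacian_eq_zero (contDiff_polyFun p) hr fun y _ => ?_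
  rw [coordLaplacian_polyFun, hp]
  simp [polyFun]

lemma pderiv_mem_restrictTotalDegree {p : MvPolynomial (Fin d) ℝ} {n : ℕ}
    (hp : p ∈ MvPolynomial.restrictTotalDegree (Fin d) ℝ (n + 1)) (i : Fin d) :
    MvPolynomial.pderiv i p ∈ MvPolynomial.restrictTotalDegree (Fin d) ℝ n := by
  rw [MvPolynomial.mem_restrictTotalDegree] at hp
  rw [p.as_sum, map_sum]
  refine Submodule.sum_mem _ fun s hs => ?_
  rw [MvPolynomial.pderiv_monomial, MvPolynomial.mem_restrictTotalDegree]
  by_cases hsi : s i = 0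
  · simp [hsi]
  · refine (MvPolynomial.totalDegree_monomial_le _ _).trans ?_
    have h1 : (s.sum fun _ e => e) ≤ n + 1 := (MvPolynomial.le_totalDegree hs).trans hp
    have h2 : s = (s - Finsupp.single i 1) + Finsupp.single i 1 :=
      (tsub_add_cancel_of_le (by simpa using Nat.one_le_iff_ne_zero.2 hsi)).symm
    rw [h2, Finsupp.sum_add_index' (by simp) (by simp)] at h1
    simp only [Finsupp.sum_single_index, add_le_add_iff_right] at h1
    exact h1

lemma polyLaplacian_mem_restrictTotalDegree {p : MvPolynomial (Fin d) ℝ} {n : ℕ}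
    (hp : p ∈ MvPolynomial.restrictTotalDegree (Fin d) ℝ (n + 2)) :
    polyLaplacian p ∈ MvPolynomial.restrictTotalDegree (Fin d) ℝ n := by
  rw [polyLaplacian_apply]
  exact Submodule.sum_mem _ fun i _ =>
    pderiv_mem_restrictTotalDegree (pderiv_mem_restrictTotalDegree hp i) i

lemma eq_zero_of_polyFun_eq_zero_on_ball {p : MvPolynomial (Fin d) ℝ} {c : Euc d} {r : ℝ}
    (hr : 0 < r) (h : ∀ x ∈ ball c r, polyFun p x = 0) : p = 0 := by
  have hopen : (WithLp.toLp 2 : (Fin d → ℝ) → Euc d) ⁻¹' ball c r ∈ 𝓝 (WithLp.ofLp c) :=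
    (PiLp.continuous_toLp 2 _).continuousAt.preimage_mem_nhds (isOpen_ball.mem_nhds
      (mem_ball_self hr))
  obtain ⟨ε, hε, hεs⟩ := Metric.mem_nhds_iff.1 hopen
  rw [ball_pi _ hε] at hεs
  refine MvPolynomial.funext_set (fun i => ball (c i) ε) (fun i => ?_) fun x hx => ?_
  · rw [Real.ball_eq_Ioo]
    exact Ioo_infinite (by linarith)
  · have := h _ (hεs hx)
    simpa [polyFun] using this

/-- The Dirichlet problem on a ball with polynomial data has a polynomial solution. -/
lemma exists_harmonic_polynomial (hd : 0 < d) (p : MvPolynomial (Fin d) ℝ) (c : Euc d) {r : ℝ}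
    (hr : 0 < r) : ∃ q : MvPolynomial (Fin d) ℝ, polyLaplacian q = 0 ∧
      ∀ x ∈ sphere c r, polyFun q x = polyFun p x := by
  set n := p.totalDegree
  set N : MvPolynomial (Fin d) ℝ := MvPolynomial.C (r ^ 2) -
    ∑ i, (MvPolynomial.X i - MvPolynomial.C (c i)) ^ 2 with hN
  have hNx : ∀ x, polyFun N x = r ^ 2 - ‖x - c‖ ^ 2 := by
    intro x
    simp [polyFun, hN, EuclideanSpace.real_norm_sq_eq]
  have hNdeg : N.totalDegree ≤ 2 := by
    refine (MvPolynomial.totalDegree_sub _ _).trans (max_le ((MvPolynomial.totalDegree_C _).le.trans (by norm_num)) ?_)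
    refine (MvPolynomial.totalDegree_finsetSum _ _).trans (Finset.sup_le fun i _ => ?_)
    refine (MvPolynomial.totalDegree_pow _ _).trans ?_
    have : (MvPolynomial.X i - MvPolynomial.C (c i) : MvPolynomial (Fin d) ℝ).totalDegree ≤ 1 :=
      (MvPolynomial.totalDegree_sub _ _).trans (by simp)
    omega
  have hmem : ∀ q ∈ MvPolynomial.restrictTotalDegree (Fin d) ℝ n,
      polyLaplacian (N * q) ∈ MvPolynomial.restrictTotalDegree (Fin d) ℝ n := by
    intro q hq
    refine polyLaplacian_mem_restrictTotalDegree ?_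
    rw [MvPolynomial.mem_restrictTotalDegree] at hq ⊢
    exact (MvPolynomial.totalDegree_mul _ _).trans (by omega)
  let T : MvPolynomial.restrictTotalDegree (Fin d) ℝ n →ₗ[ℝ]
      MvPolynomial.restrictTotalDegree (Fin d) ℝ n :=
    (polyLaplacian ∘ₗ LinearMap.mulLeft ℝ N).restrict hmem
  have hinj : Function.Injective T := by
    rw [← LinearMap.ker_eq_bot, LinearMap.ker_eq_bot']
    intro q hq
    have hq0 : polyLaplacian (N * q.1) = 0 := congrArg Subtype.val hq
    have hh := harmOn_polyFun hq0
    have hmul : ∀ x, polyFun (N * q.1) x = (r ^ 2 - ‖x - c‖ ^ 2) * polyFun q.1 x := by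
      intro x
      rw [← hNx]
      simp [polyFun]
    have hs : ∀ x ∈ sphere c r, polyFun (N * q.1) x = 0 := by
      intro x hx
      rw [hmul, mem_sphere_iff_norm.1 hx, sub_self, zero_mul]
    have h1 := hh.neg.mono (subset_univ (ball c r))
    have h0 : ∀ x ∈ closedBall c r, polyFun (N * q.1) x = 0 := fun x hx => le_antisymm
      ((hh.mono (subset_univ _)).nonpos_on_closedBall hd hr (hh.1.mono (subset_univ _))
        (fun x hx => (hs x hx).le) x hx)
      (neg_nonpos.1 (h1.nonpos_on_closedBall hd hr (hh.neg.1.mono (subset_univ _))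
        (fun x hx => by rw [hs x hx, neg_zero]) x hx))
    have : q.1 = 0 := by
      refine eq_zero_of_polyFun_eq_zero_on_ball (c := c) hr fun x hx => ?_
      have h2 := h0 x (ball_subset_closedBall hx)
      rw [hmul] at h2
      have h3 : ‖x - c‖ < r := by simpa [dist_eq_norm] using hx
      have h4 : r ^ 2 - ‖x - c‖ ^ 2 ≠ 0 := by nlinarith [norm_nonneg (x - c)]
      exact (mul_eq_zero.1 h2).resolve_left h4
    exact Subtype.ext this
  have hpmem : polyLaplacian p ∈ MvPolynomial.restrictTotalDegree (Fin d) ℝ n := by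
    refine polyLaplacian_mem_restrictTotalDegree ?_
    rw [MvPolynomial.mem_restrictTotalDegree]
    omega
  obtain ⟨q, hq⟩ := LinearMap.injective_iff_surjective.1 hinj ⟨_, hpmem⟩
  have hq' : polyLaplacian (N * q.1) = polyLaplacian p := congrArg Subtype.val hq
  refine ⟨p - N * q.1, by rw [map_sub, hq', sub_self], fun x hx => ?_⟩
  have : polyFun (p - N * q.1) x = polyFun p x - polyFun N x * polyFun q.1 x := by
    simp [polyFun]
  rw [this, hNx, mem_sphere_iff_norm.1 hx]
  ring

end PolynomialDirichlet

section DirichletProblem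

variable {d : ℕ}

lemma exists_polyFun_near {K : Set (Euc d)} (hK : IsCompact K) {f : Euc d → ℝ}
    (hf : ContinuousOn f K) {ε : ℝ} (hε : 0 < ε) :
    ∃ p : MvPolynomial (Fin d) ℝ, ∀ x ∈ K, |polyFun p x - f x| < ε := by
  have : CompactSpace K := isCompact_iff_compactSpace.1 hK
  let X : Fin d → C(K, ℝ) := fun i => ⟨fun x => (x : Euc d) i, by fun_prop⟩
  let F : MvPolynomial (Fin d) ℝ →ₐ[ℝ] C(K, ℝ) := MvPolynomial.aeval X
  have hF : ∀ p x, F p x = polyFun p x := by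
    intro p x
    induction p using MvPolynomial.induction_on with
    | C a => simp [F, polyFun]
    | add p q hp hq => simp only [map_add, ContinuousMap.add_apply, hp, hq]; simp [polyFun]
    | mul_X p i hp =>
      simp only [map_mul, ContinuousMap.mul_apply, hp]
      simp [polyFun, F, X]
  have hsep : F.range.SeparatesPoints := by
    intro x y hxy
    have : ∃ i, (x : Euc d) i ≠ (y : Euc d) i := by
      by_contra! h
      exact hxy (Subtype.ext (PiLp.ext h))
    obtain ⟨i, hi⟩ := this
    refine ⟨X i, ⟨X i, ⟨MvPolynomial.X i, ?_⟩, rfl⟩, hi⟩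
    simp [F]
  obtain ⟨⟨g, p, hp⟩, hg⟩ := ContinuousMap.exists_mem_subalgebra_near_continuous_of_separatesPoints
    F.range hsep (fun x : K => f x) (continuousOn_iff_continuous_domRestrict.1 hf) ε hε
  refine ⟨p, fun x hx => ?_⟩
  have h1 := hg ⟨x, hx⟩
  rw [← hF p ⟨x, hx⟩]
  have hp' : F p = g := hp
  rw [hp']
  exact h1

/-- A bounded pointwise limit of harmonic functions is harmonic. -/
lemma HarmOn.of_tendsto {U : Set (Euc d)} (hU : IsOpen U) {h : ℕ → Euc d → ℝ} {H : Euc d → ℝ}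
    {M : ℝ} (hh : ∀ n, HarmOn (h n) U) (hM : ∀ n, ∀ x ∈ U, |h n x| ≤ M)
    (hlim : ∀ x ∈ U, Tendsto (fun n => h n x) atTop (𝓝 (H x))) : HarmOn H U := by
  have hHM : ∀ x ∈ U, |H x| ≤ M := fun x hx =>
    le_of_tendsto (hlim x hx).abs (Eventually.of_forall fun n => hM n x hx)
  have hm : ∀ x : Euc d, ∀ r : ℝ, closedBall x r ⊆ U →
      AEStronglyMeasurable H (volume.restrict (closedBall x r)) := by
    intro x r hx
    refine aestronglyMeasurable_of_tendsto_ae atTop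
      (fun n => ((hh n).1.integrableOn_closedBall hx).aestronglyMeasurable) ?_
    exact (ae_restrict_iff' measurableSet_closedBall).2 (ae_of_all _ fun y hy => hlim y (hx hy))
  have hmv : ∀ x : Euc d, ∀ r : ℝ, 0 < r → closedBall x r ⊆ U →
      H x = ⨍ y in closedBall x r, H y := by
    intro x r hr hx
    rw [eq_setAverage_closedBall_iff hr]
    have h1 : Tendsto (fun n => ∫ y in closedBall x r, h n y) atTop
        (𝓝 (∫ y in closedBall x r, H y)) := by
      refine tendsto_integral_of_dominated_convergence (fun _ => M)
        (fun n => ((hh n).1.integrableOn_closedBall hx).aestronglyMeasurable)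
        (integrableOn_const measure_closedBall_lt_top.ne)
        (fun n => (ae_restrict_iff' measurableSet_closedBall).2
          (ae_of_all _ fun y hy => hM n y (hx hy)))
        ((ae_restrict_iff' measurableSet_closedBall).2 (ae_of_all _ fun y hy => hlim y (hx hy)))
    refine tendsto_nhds_unique h1 ?_
    simp only [fun n => (eq_setAverage_closedBall_iff hr).1 ((hh n).2 x r hr hx)]
    exact (hlim x (hx (mem_closedBall_self hr.le))).const_mul _
  refine ⟨fun x₀ hx₀ => ContinuousAt.continuousWithinAt ?_, hmv⟩
  obtain ⟨r, hr, hrU⟩ : ∃ r > 0, closedBall x₀ (r + r) ⊆ U := by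
    obtain ⟨r, hr, hrU⟩ := Metric.nhds_basis_closedBall.mem_iff.1 (hU.mem_nhds hx₀)
    exact ⟨r / 2, half_pos hr, by simpa using hrU⟩
  have hsub : ∀ y ∈ ball x₀ r, closedBall y r ⊆ closedBall x₀ (r + r) := fun y hy =>
    closedBall_subset_closedBall' (by linarith [mem_ball.1 hy])
  have key : ContinuousAt (fun y => ∫ z, (closedBall y r).indicator H z) x₀ := by
    refine continuousAt_of_dominated (bound := (closedBall x₀ (r + r)).indicator fun _ => M)
      ?_ ?_ ?_ ?_
    · filter_upwards [ball_mem_nhds x₀ hr] with y hy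
      exact (aestronglyMeasurable_indicator_iff measurableSet_closedBall).2
        (hm y r ((hsub y hy).trans hrU))
    · filter_upwards [ball_mem_nhds x₀ hr] with y hy
      refine ae_of_all _ fun z => ?_
      by_cases hz : z ∈ closedBall y r
      · rw [indicator_of_mem hz, indicator_of_mem (hsub y hy hz)]
        exact hHM z (hrU (hsub y hy hz))
      · rw [indicator_of_notMem hz, norm_zero]
        exact indicator_nonneg (fun _ _ => (abs_nonneg _).trans (hHM x₀ hx₀)) _
    · exact (integrable_indicator_iff measurableSet_closedBall).2
        (integrableOn_const measure_closedBall_lt_top.ne)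
    · have h0 : volume (sphere x₀ r) = 0 := Measure.addHaar_sphere_of_ne_zero _ _ hr.ne'
      filter_upwards [compl_mem_ae_iff.2 h0] with z hz
      have hz' : dist z x₀ ≠ r := hz
      refine ContinuousAt.congr (f := fun _ => (closedBall x₀ r).indicator H z)
        continuousAt_const ?_
      rcases lt_or_gt_of_ne hz' with h | h
      · filter_upwards [(continuous_const.dist continuous_id).continuousAt.eventually_lt
          (continuousAt_const (y := r)) h] with y hy
        have hy' : dist z y < r := hy
        rw [indicator_of_mem (mem_closedBall.2 h.le), indicator_of_mem (mem_closedBall.2 hy'.le)]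
      · filter_upwards [(continuousAt_const (y := r)).eventually_lt
          (continuous_const.dist continuous_id).continuousAt h] with y hy
        have hy' : r < dist z y := hy
        rw [indicator_of_notMem (fun h' => h.not_ge (mem_closedBall.1 h')),
          indicator_of_notMem (fun h' => hy'.not_ge (mem_closedBall.1 h'))]
  have hv : 0 < volume.real (closedBall (0 : Euc d) r) :=
    ENNReal.toReal_pos (measure_closedBall_pos volume _ hr).ne' measure_closedBall_lt_top.ne
  have key2 := key.const_mul (volume.real (closedBall (0 : Euc d) r))⁻¹
  refine key2.congr ?_
  filter_upwards [ball_mem_nhds x₀ hr] with y hy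
  have h1 := (eq_setAverage_closedBall_iff hr).1 (hmv y r hr ((hsub y hy).trans hrU))
  have h2 : volume.real (closedBall y r) = volume.real (closedBall (0 : Euc d) r) := by
    rw [measureReal_def, Measure.addHaar_closedBall_center, ← measureReal_def]
  rw [integral_indicator measurableSet_closedBall, h1, h2,
    inv_mul_cancel_left₀ (ne_of_gt hv)]

/-- A harmonic function on a ball that is continuous up to the boundary is approximated uniformly
by harmonic polynomials; any continuous boundary datum is attained by such a function. -/
lemma exists_harmonic_polynomial_near_on_sphere (hd : 0 < d) {c : Euc d} {r : ℝ} (hr : 0 < r)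
    {f : Euc d → ℝ} (hf : ContinuousOn f (sphere c r)) {ε : ℝ} (hε : 0 < ε) :
    ∃ q : MvPolynomial (Fin d) ℝ, polyLaplacian q = 0 ∧
      ∀ x ∈ sphere c r, |polyFun q x - f x| < ε := by
  obtain ⟨p, hp⟩ := exists_polyFun_near (isCompact_sphere c r) hf hε
  obtain ⟨q, hq, hqp⟩ := exists_harmonic_polynomial hd p c hr
  exact ⟨q, hq, fun x hx => by rw [hqp x hx]; exact hp x hx⟩

lemma HarmOn.abs_sub_le_on_closedBall (hd : 0 < d) {c : Euc d} {r : ℝ} (hr : 0 < r)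
    {f g : Euc d → ℝ} (hf : ContinuousOn f (closedBall c r)) (hfh : HarmOn f (ball c r))
    (hg : ContinuousOn g (closedBall c r)) (hgh : HarmOn g (ball c r)) {ε : ℝ}
    (hb : ∀ x ∈ sphere c r, |f x - g x| ≤ ε) : ∀ x ∈ closedBall c r, |f x - g x| ≤ ε := by
  intro x hx
  rw [abs_sub_le_iff]
  constructor
  · have := hfh.le_on_closedBall hd hr hf (g := fun y => g y + ε) (hg.add continuousOn_const)
      (hgh.add (harmOn_const ε _)) (fun y hy => by
        linarith [(abs_sub_le_iff.1 (hb y hy)).1]) x hx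
    linarith
  · have := hgh.le_on_closedBall hd hr hg (g := fun y => f y + ε) (hf.add continuousOn_const)
      (hfh.add (harmOn_const ε _)) (fun y hy => by
        linarith [(abs_sub_le_iff.1 (hb y hy)).2]) x hx
    linarith

lemma exists_harmonic_polynomial_near (hd : 0 < d) {c : Euc d} {r : ℝ} (hr : 0 < r)
    {f : Euc d → ℝ} (hf : ContinuousOn f (closedBall c r)) (hfh : HarmOn f (ball c r))
    {ε : ℝ} (hε : 0 < ε) :
    ∃ q : MvPolynomial (Fin d) ℝ, polyLaplacian q = 0 ∧
      ∀ x ∈ closedBall c r, |polyFun q x - f x| ≤ ε := by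
  obtain ⟨q, hq, hqf⟩ := exists_harmonic_polynomial_near_on_sphere hd hr
    (hf.mono sphere_subset_closedBall) hε
  exact ⟨q, hq, HarmOn.abs_sub_le_on_closedBall hd hr ((harmOn_polyFun hq).1.mono (subset_univ _))
    ((harmOn_polyFun hq).mono (subset_univ _)) hf hfh fun x hx => (hqf x hx).le⟩

/-- Solvability of the Dirichlet problem on a ball. -/
theorem exists_dirichlet_solution (hd : 0 < d) {c : Euc d} {r : ℝ} (hr : 0 < r)
    {f : Euc d → ℝ} (hf : ContinuousOn f (sphere c r)) :
    ∃ h : Euc d → ℝ, ContinuousOn h (closedBall c r) ∧ HarmOn h (ball c r) ∧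
      ∀ x ∈ sphere c r, h x = f x := by
  choose q hq hqf using fun n : ℕ => exists_harmonic_polynomial_near_on_sphere hd hr hf
    (Nat.one_div_pos_of_nat (α := ℝ) (n := n))
  have hharm : ∀ n, HarmOn (polyFun (q n)) univ := fun n => harmOn_polyFun (hq n)
  have hclose : ∀ N m n, N ≤ m → N ≤ n → ∀ x ∈ closedBall c r,
      |polyFun (q m) x - polyFun (q n) x| ≤ 2 * (1 / ((N : ℝ) + 1)) := by
    intro N m n hm hn
    refine HarmOn.abs_sub_le_on_closedBall hd hr ((hharm m).1.mono (subset_univ _))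
      ((hharm m).mono (subset_univ _)) ((hharm n).1.mono (subset_univ _))
      ((hharm n).mono (subset_univ _)) fun x hx => ?_
    have h1 := (hqf m x hx).le.trans (Nat.one_div_le_one_div hm)
    have h2 := (hqf n x hx).le.trans (Nat.one_div_le_one_div hn)
    rw [abs_le] at h1 h2 ⊢
    constructor <;> linarith
  have h0 : Tendsto (fun N : ℕ => 2 * (1 / ((N : ℝ) + 1))) atTop (𝓝 0) := by
    simpa using tendsto_one_div_add_atTop_nhds_zero_nat.const_mul (2 : ℝ)
  have hcau : UniformCauchySeqOn (fun n => polyFun (q n)) atTop (closedBall c r) := by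
    rw [Metric.uniformCauchySeqOn_iff]
    intro ε hε
    obtain ⟨N, hN⟩ := (h0.eventually (gt_mem_nhds hε)).exists
    exact ⟨N, fun m hm n hn x hx => (hclose N m n hm hn x hx).trans_lt hN⟩
  have hpt : ∀ x, ∃ y, x ∈ closedBall c r → Tendsto (fun n => polyFun (q n) x) atTop (𝓝 y) := by
    intro x
    by_cases hx : x ∈ closedBall c r
    · obtain ⟨y, hy⟩ := cauchySeq_tendsto_of_complete (hcau.cauchySeq hx)
      exact ⟨y, fun _ => hy⟩
    · exact ⟨0, fun h => absurd h hx⟩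
  choose H hH using hpt
  have hunif := hcau.tendstoUniformlyOn_of_tendsto hH
  refine ⟨H, hunif.continuousOn (Frequently.of_forall fun n =>
    (hharm n).1.mono (subset_univ _)), ?_, ?_⟩
  · obtain ⟨M, hM⟩ := (isCompact_closedBall c r).exists_bound_of_continuousOn
      ((hharm 0).1.mono (subset_univ _))
    refine HarmOn.of_tendsto (M := M + 2) isOpen_ball
      (fun n => (hharm n).mono (subset_univ _)) (fun n x hx => ?_)
      fun x hx => hH x (ball_subset_closedBall hx)
    have h1 := hclose 0 n 0 n.zero_le le_rfl x (ball_subset_closedBall hx)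
    have h2 := hM x (ball_subset_closedBall hx)
    rw [Real.norm_eq_abs] at h2
    have h3 : |polyFun (q n) x| ≤ |polyFun (q n) x - polyFun (q 0) x| + |polyFun (q 0) x| := by
      simpa using abs_add_le (polyFun (q n) x - polyFun (q 0) x) (polyFun (q 0) x)
    norm_num at h1
    linarith
  · intro x hx
    refine tendsto_nhds_unique (hH x (sphere_subset_closedBall hx)) ?_
    rw [tendsto_iff_dist_tendsto_zero]
    exact squeeze_zero (fun _ => dist_nonneg) (fun n => (hqf n x hx).le)
      tendsto_one_div_add_atTop_nhds_zero_nat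

/-- The mean value property on a closed ball for functions harmonic in its interior. -/
lemma HarmOn.eq_setAverage_closedBall {f : Euc d → ℝ} {x : Euc d} {r : ℝ} (hr : 0 < r)
    (hf : ContinuousOn f (closedBall x r)) (hh : HarmOn f (ball x r)) :
    f x = ⨍ y in closedBall x r, f y := by
  obtain ⟨M, hM⟩ := (isCompact_closedBall x r).exists_bound_of_continuousOn hf
  rw [eq_setAverage_closedBall_iff hr, setIntegral_closedBall_eq_unit f x hr,
    volume_real_closedBall_eq_unit x hr, mul_assoc]
  congr 1
  have hmem : ∀ t ∈ Icc (0 : ℝ) 1, ∀ y ∈ closedBall (0 : Euc d) 1,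
      x + (t * r) • y ∈ closedBall x r := by
    intro t ht y hy
    rw [mem_closedBall_zero_iff] at hy
    rw [mem_closedBall_iff_norm, add_sub_cancel_left, norm_smul, Real.norm_eq_abs,
      abs_of_nonneg (mul_nonneg ht.1 hr.le)]
    calc t * r * ‖y‖ ≤ 1 * r * 1 := by gcongr; exact ht.2
      _ = r := by ring
  have hcont : ContinuousOn (fun t : ℝ => ∫ y in closedBall (0 : Euc d) 1, f (x + (t * r) • y))
      (Icc 0 1) := by
    refine continuousOn_of_dominated (bound := fun _ => M) (fun t ht => ?_) (fun t ht => ?_)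
      (integrableOn_const measure_closedBall_lt_top.ne) ?_
    · refine (ContinuousOn.integrableOn_compact (isCompact_closedBall _ _) ?_).aestronglyMeasurable
      exact hf.comp (by fun_prop) fun y hy => hmem t ht y hy
    · exact (ae_restrict_iff' measurableSet_closedBall).2
        (ae_of_all _ fun y hy => hM _ (hmem t ht y hy))
    · exact (ae_restrict_iff' measurableSet_closedBall).2
        (ae_of_all _ fun y hy => hf.comp (by fun_prop) fun t ht => hmem t ht y hy)
  have hconst : ∀ t ∈ Ioo (0 : ℝ) 1, ∫ y in closedBall (0 : Euc d) 1, f (x + (t * r) • y) =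
      volume.real (closedBall (0 : Euc d) 1) * f x := by
    intro t ht
    have htr : 0 < t * r := mul_pos ht.1 hr
    have h1 := (eq_setAverage_closedBall_iff htr).1 (hh.2 x (t * r) htr
      (closedBall_subset_ball (by nlinarith [ht.2])))
    rw [setIntegral_closedBall_eq_unit f x htr, volume_real_closedBall_eq_unit x htr,
      mul_assoc] at h1
    exact mul_left_cancel₀ (pow_pos htr d).ne' h1
  have hlim := ((hcont 1 (right_mem_Icc.2 zero_le_one)).mono Ioo_subset_Icc_self).tendsto
  have : (𝓝[Ioo (0 : ℝ) 1] 1).NeBot := by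
    rw [nhdsWithin_Ioo_eq_nhdsLT zero_lt_one]; infer_instance
  have := tendsto_nhds_unique hlim ((tendsto_const_nhds
    (x := volume.real (closedBall (0 : Euc d) 1) * f x)).congr' ?_)
  · simpa using this
  · filter_upwards [self_mem_nhdsWithin] with t ht
    exact (hconst t ht).symm

/-- Harmonicity is a local property. -/
theorem HarmOn.of_local (hd : 0 < d) {h : Euc d → ℝ} {U : Set (Euc d)}
    (hloc : ∀ x ∈ U, ∃ ε > 0, HarmOn h (ball x ε)) : HarmOn h U := by
  have hc : ∀ x ∈ U, ContinuousAt h x := fun x hx => by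
    obtain ⟨ε, hε, hh⟩ := hloc x hx
    exact hh.1.continuousAt (ball_mem_nhds x hε)
  refine ⟨fun x hx => (hc x hx).continuousWithinAt, fun x r hr hxU => ?_⟩
  have hcl : closure (ball x r) = closedBall x r := closure_ball x hr.ne'
  have hcB : ContinuousOn h (closedBall x r) := fun y hy => (hc y (hxU hy)).continuousWithinAt
  obtain ⟨g, hg, hgh, hgs⟩ := exists_dirichlet_solution hd hr (hcB.mono sphere_subset_closedBall)
  have hle : ∀ (w : Euc d → ℝ), ContinuousOn w (closedBall x r) →
      (∀ y ∈ ball x r, ∃ ε > 0, HarmOn w (ball y ε)) → (∀ y ∈ sphere x r, w y = 0) →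
      ∀ y ∈ closedBall x r, w y ≤ 0 := by
    intro w hw hwl hws
    rw [← hcl] at hw ⊢
    refine nonpos_of_le_setAverage hd isOpen_ball isBounded_ball hw.upperSemicontinuousOn
      (fun y hy => ?_) fun y hy hy' => (hws y ?_).le
    · obtain ⟨ε, hε, hwε⟩ := hwl y hy
      obtain ⟨ρ, hρ, hρs⟩ := Metric.nhds_basis_closedBall.mem_iff.1
        (inter_mem (ball_mem_nhds y hε) (isOpen_ball.mem_nhds hy))
      have h1 := hρs.trans inter_subset_left
      exact ⟨ρ, hρ, hρs.trans inter_subset_right, hwε.1.integrableOn_closedBall h1,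
        (hwε.2 y ρ hρ h1).le⟩
    · rw [hcl] at hy
      exact le_antisymm hy (not_lt.1 hy')
  have hd' : ∀ y ∈ ball x r, ∃ ε > 0, HarmOn h (ball y ε) ∧ HarmOn g (ball y ε) := by
    intro y hy
    obtain ⟨ε, hε, hwε⟩ := hloc y (hxU (ball_subset_closedBall hy))
    obtain ⟨ρ, hρ, hρs⟩ := Metric.mem_nhds_iff.1 (isOpen_ball.mem_nhds hy)
    exact ⟨min ε ρ, lt_min hε hρ, hwε.mono (ball_subset_ball (min_le_left _ _)),
      hgh.mono ((ball_subset_ball (min_le_right _ _)).trans hρs)⟩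
  have heq : EqOn h g (closedBall x r) := by
    intro y hy
    refine le_antisymm (sub_nonpos.1 ?_) (sub_nonpos.1 ?_)
    · refine hle (fun y => h y - g y) (hcB.sub hg) (fun y hy => ?_)
        (fun y hy => by simp [hgs y hy]) y hy
      obtain ⟨ε, hε, h1, h2⟩ := hd' y hy
      exact ⟨ε, hε, h1.sub h2⟩
    · refine hle (fun y => g y - h y) (hg.sub hcB) (fun y hy => ?_)
        (fun y hy => by simp [hgs y hy]) y hy
      obtain ⟨ε, hε, h1, h2⟩ := hd' y hy
      exact ⟨ε, hε, h2.sub h1⟩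
  exact (hgh.congr (heq.mono ball_subset_closedBall)).eq_setAverage_closedBall hr hcB

end DirichletProblem
section PoissonModification

variable {d : ℕ}

lemma UpperSemicontinuousOn.exists_antitone_continuous {α : Type*} [PseudoMetricSpace α] {K : Set α}
    (hK : IsCompact K) {v : α → ℝ} (hv : UpperSemicontinuousOn v K) :
    ∃ φ : ℕ → α → ℝ, (∀ n, Continuous (φ n)) ∧ (∀ y, Antitone fun n => φ n y) ∧
      (∀ n, ∀ y ∈ K, v y ≤ φ n y) ∧ ∀ y ∈ K, ∀ ε > 0, ∃ n, φ n y < v y + ε := by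
  rcases K.eq_empty_or_nonempty with rfl | hne
  · exact ⟨fun _ _ => 0, fun _ => continuous_const, fun _ => antitone_const, by simp, by simp⟩
  have : Nonempty K := hne.to_subtype
  obtain ⟨M, hM⟩ := hv.bddAbove_of_isCompact hK
  have hMK : ∀ z : K, v z ≤ M := fun z => hM (mem_image_of_mem v z.2)
  have hbdd : ∀ (n : ℕ) (y : α), BddAbove (range fun z : K => v z - n * dist y z) := fun n y =>
    ⟨M, by
      rintro _ ⟨z, rfl⟩
      have := mul_nonneg (n.cast_nonneg : (0 : ℝ) ≤ n) (dist_nonneg (x := y) (y := (z : α)))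
      linarith [hMK z]⟩
  refine ⟨fun n y => ⨆ z : K, (v z - n * dist y z), fun n => ?_, fun y m n hmn => ?_,
    fun n y hy => ?_, fun y hy ε hε => ?_⟩
  · refine (LipschitzWith.of_le_add_mul (n : NNReal) fun x y => ciSup_le fun z => ?_).continuous
    have h1 := le_ciSup (hbdd n y) z
    have h2 : dist y z ≤ dist x z + dist x y := by
      rw [dist_comm x y]; linarith [dist_triangle y x z]
    have h3 := mul_le_mul_of_nonneg_left h2 (n.cast_nonneg : (0 : ℝ) ≤ n)
    simp only [NNReal.coe_natCast] at h1 ⊢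
    linarith
  · refine ciSup_mono (hbdd m y) fun z => ?_
    have : (m : ℝ) ≤ n := by exact_mod_cast hmn
    have := mul_le_mul_of_nonneg_right this (dist_nonneg (x := y) (y := (z : α)))
    linarith
  · simpa using le_ciSup (hbdd n y) ⟨y, hy⟩
  · have hev : ∀ᶠ z in 𝓝[K] y, v z < v y + ε / 2 := hv y hy _ (by linarith)
    obtain ⟨ρ, hρ, hρs⟩ := Metric.mem_nhdsWithin_iff.1 hev
    obtain ⟨n, hn⟩ := exists_nat_gt ((M - v y) / ρ)
    refine ⟨n, (ciSup_le fun z => ?_).trans_lt (show v y + ε / 2 < v y + ε by linarith)⟩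
    by_cases hz : dist (z : α) y < ρ
    · have h1 : v z < v y + ε / 2 := hρs ⟨hz, z.2⟩
      have := mul_nonneg (n.cast_nonneg : (0 : ℝ) ≤ n) (dist_nonneg (x := y) (y := (z : α)))
      linarith
    · rw [dist_comm] at hz
      rw [div_lt_iff₀ hρ] at hn
      have h1 := mul_le_mul_of_nonneg_left (not_lt.1 hz) (n.cast_nonneg : (0 : ℝ) ≤ n)
      linarith [hMK z]

/-- Subharmonicity of a real-valued function. -/
structure SubharmOn (v : Euc d → ℝ) (O : Set (Euc d)) : Prop where
  usc : UpperSemicontinuousOn v O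
  le_of_sphere : ∀ x : Euc d, ∀ r : ℝ, 0 < r → closedBall x r ⊆ O → ∀ h : Euc d → ℝ,
    ContinuousOn h (closedBall x r) → HarmOn h (ball x r) → (∀ y ∈ sphere x r, v y ≤ h y) →
      ∀ y ∈ closedBall x r, v y ≤ h y

lemma SubharmOn.sbhOn {v : Euc d → ℝ} {O : Set (Euc d)} (hv : SubharmOn v O) :
    SbhOn (fun x => (v x : EReal)) O := by
  refine ⟨continuous_coe_real_ereal.comp_upperSemicontinuousOn hv.usc
    EReal.coe_strictMono.monotone, fun x _ => EReal.coe_lt_top _, ?_⟩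
  intro x r hr hx h hc hh hb y hy
  exact EReal.coe_le_coe (hv.le_of_sphere x r hr hx h hc hh
    (fun z hz => EReal.coe_le_coe_iff.1 (hb z hz)) y hy)

/-- A harmonic majorant on a ball, attaining the boundary values of a bounded below
subharmonic function. -/
lemma SubharmOn.exists_harmonic_majorant (hd : 0 < d) {v : Euc d → ℝ} {O : Set (Euc d)}
    (hv : SubharmOn v O) {L : ℝ} (hL : ∀ x, L ≤ v x) {c : Euc d} {r : ℝ} (hr : 0 < r)
    (hO : closedBall c r ⊆ O) :
    ∃ H : Euc d → ℝ, HarmOn H (ball c r) ∧ (∀ x ∈ ball c r, v x ≤ H x) ∧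
      ∀ x ∈ sphere c r, ∀ ε > 0, ∀ᶠ y in 𝓝 x, y ∈ ball c r → H y < v x + ε := by
  obtain ⟨φ, hφc, hφa, hφv, hφl⟩ := (hv.usc.mono
    (sphere_subset_closedBall.trans hO)).exists_antitone_continuous (isCompact_sphere c r)
  choose h hc hh hs using fun n => exists_dirichlet_solution hd hr
    ((hφc n).continuousOn (s := sphere c r))
  have hvh : ∀ n, ∀ x ∈ closedBall c r, v x ≤ h n x := fun n =>
    hv.le_of_sphere c r hr hO (h n) (hc n) (hh n) fun y hy => by rw [hs n y hy]; exact hφv n y hy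
  have hanti : ∀ m n, m ≤ n → ∀ x ∈ closedBall c r, h n x ≤ h m x := fun m n hmn =>
    (hh n).le_on_closedBall hd hr (hc n) (hc m) (hh m) fun y hy => by
      rw [hs n y hy, hs m y hy]; exact hφa y hmn
  have hbdd : ∀ x ∈ closedBall c r, BddBelow (range fun n => h n x) := fun x hx =>
    ⟨v x, by rintro _ ⟨n, rfl⟩; exact hvh n x hx⟩
  obtain ⟨M, hM⟩ := (isCompact_closedBall c r).exists_bound_of_continuousOn (hc 0)
  refine ⟨fun x => ⨅ n, h n x, ?_, ?_, ?_⟩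
  · refine HarmOn.of_tendsto (M := max M (-L)) isOpen_ball hh (fun n x hx => ?_) fun x hx =>
      tendsto_atTop_ciInf (fun m n hmn => hanti m n hmn x (ball_subset_closedBall hx))
        (hbdd x (ball_subset_closedBall hx))
    have hx' := ball_subset_closedBall hx
    rw [abs_le]
    have h1 := hL x
    have h2 := hvh n x hx'
    have h3 := hanti 0 n n.zero_le x hx'
    have h4 := (le_abs_self _).trans (hM x hx')
    exact ⟨by linarith [le_max_right M (-L)], by linarith [le_max_left M (-L)]⟩
  · exact fun x hx => le_ciInf fun n => hvh n x (ball_subset_closedBall hx)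
  · intro x hx ε hε
    obtain ⟨n, hn⟩ := hφl x hx ε hε
    have h1 : ∀ᶠ y in 𝓝[closedBall c r] x, h n y < v x + ε :=
      (hc n x (sphere_subset_closedBall hx)).eventually_lt continuousWithinAt_const
        (by rw [hs n x hx]; exact hn)
    filter_upwards [eventually_nhdsWithin_iff.1 h1] with y hy hyb
    exact (ciInf_le (hbdd y (ball_subset_closedBall hyb)) n).trans_lt
      (hy (ball_subset_closedBall hyb))

/-- Poisson modification of a subharmonic function in a ball. -/
theorem SubharmOn.exists_poisson_modification (hd : 0 < d) {v : Euc d → ℝ} {O : Set (Euc d)}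
    (hv : SubharmOn v O) (hvm : Measurable v) {L : ℝ} (hL : ∀ x, L ≤ v x)
    {c : Euc d} {r : ℝ} (hr : 0 < r) (hcO : closedBall c r ⊆ O) :
    ∃ v' : Euc d → ℝ, SubharmOn v' O ∧ Measurable v' ∧ (∀ x, v x ≤ v' x) ∧
      (∀ x, x ∉ ball c r → v' x = v x) ∧ HarmOn v' (ball c r) := by
  classical
  obtain ⟨H, hH, hvH, hHs⟩ := hv.exists_harmonic_majorant hd hL hr hcO
  have hin : ∀ x ∈ ball c r, (ball c r).piecewise H v x = H x := fun x hx =>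
    piecewise_eq_of_mem _ _ _ hx
  have hout : ∀ x, x ∉ ball c r → (ball c r).piecewise H v x = v x := fun x hx =>
    piecewise_eq_of_notMem _ _ _ hx
  have hle : ∀ x, v x ≤ (ball c r).piecewise H v x := by
    intro x
    by_cases hx : x ∈ ball c r
    · rw [hin x hx]; exact hvH x hx
    · rw [hout x hx]
  have hharm : HarmOn ((ball c r).piecewise H v) (ball c r) := hH.congr hin
  have husc : UpperSemicontinuousOn ((ball c r).piecewise H v) O := by
    intro x hx
    by_cases hxb : x ∈ ball c r
    · exact (hharm.1.continuousAt (isOpen_ball.mem_nhds hxb)).upperSemicontinuousAt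
        |>.upperSemicontinuousWithinAt _
    · intro y hy
      rw [hout x hxb] at hy
      by_cases hxs : x ∈ sphere c r
      · have h1 := hHs x hxs (y - v x) (sub_pos.2 hy)
        filter_upwards [nhdsWithin_le_nhds h1, hv.usc x hx y hy] with z hz1 hz2
        by_cases hz : z ∈ ball c r
        · rw [hin z hz]; linarith [hz1 hz]
        · rwa [hout z hz]
      · have hx' : x ∈ (closedBall c r)ᶜ := fun h =>
          hxs (le_antisymm h (not_lt.1 hxb))
        filter_upwards [nhdsWithin_le_nhds (isClosed_closedBall.isOpen_compl.mem_nhds hx'),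
          hv.usc x hx y hy] with z hz1 hz2
        rwa [hout z fun h => hz1 (ball_subset_closedBall h)]
  refine ⟨(ball c r).piecewise H v, ⟨husc, ?_⟩, ?_, hle, hout, hharm⟩
  · intro x' r' hr' hx' h hc hh hb
    have hvh := hv.le_of_sphere x' r' hr' hx' h hc hh fun y hy => (hle y).trans (hb y hy)
    set W := ball c r ∩ ball x' r'
    have hWo : IsOpen W := isOpen_ball.inter isOpen_ball
    have hWc : closure W ⊆ closedBall x' r' :=
      (closure_mono inter_subset_right).trans closure_ball_subset_closedBall
    have hbd : ∀ y ∈ closedBall x' r', y ∉ W → (ball c r).piecewise H v y ≤ h y := by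
      intro y hy hyW
      by_cases hyb : y ∈ ball c r
      · exact hb y (le_antisymm hy (not_lt.1 fun hlt => hyW ⟨hyb, hlt⟩))
      · rw [hout y hyb]; exact hvh y hy
    have hW : ∀ y ∈ closure W, (ball c r).piecewise H v y - h y ≤ 0 := by
      refine HarmOn.nonpos_of_boundary hd hWo (isBounded_ball.subset inter_subset_left) ?_
        ((hharm.mono inter_subset_left).sub (hh.mono inter_subset_right))
        fun y hy hyW => sub_nonpos.2 (hbd y (hWc hy) hyW)
      simpa [sub_eq_add_neg] using (husc.mono (hWc.trans hx')).add
        (hc.mono hWc).neg.upperSemicontinuousOn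
    intro y hy
    by_cases hyW : y ∈ W
    · exact sub_nonpos.1 (hW y (subset_closure hyW))
    · exact hbd y hy hyW
  · have h1 : Measurable ((ball c r).piecewise H 0) :=
      hH.1.measurable_piecewise continuousOn_const measurableSet_ball
    have h2 : (ball c r).piecewise H v = (ball c r).piecewise ((ball c r).piecewise H 0) v := by
      ext x
      by_cases hx : x ∈ ball c r <;> simp [hx]
    rw [h2]
    exact h1.piecewise measurableSet_ball hvm

end PoissonModification
section HarmonicMajorant

variable {d : ℕ}

/-- A bounded below subharmonic function is the initial term of an increasing sequence of
subharmonic functions, all equal to it off a relatively compact open set `V`,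
which increases in `V` to a harmonic function. -/
theorem SubharmOn.exists_seq_tendsto_harmonic (hd : 0 < d) {v : Euc d → ℝ} {O V : Set (Euc d)}
    (hv : SubharmOn v O) (hvm : Measurable v) {L : ℝ} (hL : ∀ x, L ≤ v x)
    (hV : IsOpen V) (hVc : IsCompact (closure V)) (hVO : closure V ⊆ O) :
    ∃ (w : ℕ → Euc d → ℝ) (H : Euc d → ℝ) (M : ℝ), (∀ n, SubharmOn (w n) O) ∧
      (∀ n, Measurable (w n)) ∧ (∀ n x, v x ≤ w n x) ∧ (∀ n, ∀ x, x ∉ V → w n x = v x) ∧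
      (∀ n, ∀ x ∈ V, w n x ≤ M) ∧ HarmOn H V ∧
      ∀ x ∈ V, Tendsto (fun n => w n x) atTop (𝓝 (H x)) := by
  obtain ⟨M, hM⟩ := (hv.usc.mono hVO).bddAbove_of_isCompact hVc
  have hM' : ∀ x ∈ V, v x ≤ M := fun x hx => hM (mem_image_of_mem v (subset_closure hx))
  let P : (Euc d → ℝ) → Prop := fun w => SubharmOn w O ∧ Measurable w ∧ (∀ x, v x ≤ w x) ∧
    (∀ x, x ∉ V → w x = v x) ∧ ∀ x ∈ V, w x ≤ M
  let cen : ℕ → Euc d := fun n => TopologicalSpace.denseSeq (Euc d) (Nat.unpair (Nat.unpair n).1).1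
  let rad : ℕ → ℝ := fun n => 1 / (((Nat.unpair (Nat.unpair n).1).2 : ℝ) + 1)
  have hrad : ∀ n, 0 < rad n := fun n => Nat.one_div_pos_of_nat
  have hstep : ∀ (n : ℕ) (w : {w // P w}), ∃ w' : {w // P w}, (∀ x, w.1 x ≤ w'.1 x) ∧
      (closedBall (cen n) (rad n) ⊆ V → HarmOn w'.1 (ball (cen n) (rad n))) := by
    rintro n ⟨w, hw1, hw2, hw3, hw4, hw5⟩
    by_cases hn : closedBall (cen n) (rad n) ⊆ V
    · have hnO : closedBall (cen n) (rad n) ⊆ O := hn.trans (subset_closure.trans hVO)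
      obtain ⟨w', h1, h2, h3, h4, h5⟩ := hw1.exists_poisson_modification hd hw2
        (fun x => (hL x).trans (hw3 x)) (hrad n) hnO
      refine ⟨⟨w', h1, h2, fun x => (hw3 x).trans (h3 x), fun x hx => ?_, fun x hx => ?_⟩, h3,
        fun _ => h5⟩
      · rw [h4 x fun h => hx (hn (ball_subset_closedBall h)), hw4 x hx]
      · by_cases hxb : x ∈ ball (cen n) (rad n)
        · refine h1.le_of_sphere _ _ (hrad n) hnO (fun _ => M) continuousOn_const
            (harmOn_const _ _) (fun y hy => ?_) x (ball_subset_closedBall hxb)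
          rw [h4 y fun h => (mem_ball.1 h).ne hy]
          exact hw5 y (hn (sphere_subset_closedBall hy))
        · rw [h4 x hxb]; exact hw5 x hx
    · exact ⟨⟨w, hw1, hw2, hw3, hw4, hw5⟩, fun x => le_rfl, fun h => absurd h hn⟩
  choose step hstep1 hstep2 using hstep
  let W : ℕ → {w // P w} := fun n =>
    Nat.rec (⟨v, hv, hvm, fun _ => le_rfl, fun _ _ => rfl, hM'⟩ : {w // P w}) step n
  have hWs : ∀ n, W (n + 1) = step n (W n) := fun n => rfl
  have hmono : ∀ x, Monotone fun n => (W n).1 x := fun x => monotone_nat_of_le_succ fun n => by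
    rw [hWs]; exact hstep1 n (W n) x
  have hbdd : ∀ x ∈ V, BddAbove (range fun n => (W n).1 x) := fun x hx =>
    ⟨M, by rintro _ ⟨n, rfl⟩; exact (W n).2.2.2.2.2 x hx⟩
  have htend : ∀ x ∈ V, Tendsto (fun n => (W n).1 x) atTop (𝓝 (⨆ n, (W n).1 x)) := fun x hx =>
    tendsto_atTop_ciSup (hmono x) (hbdd x hx)
  refine ⟨fun n => (W n).1, fun x => ⨆ n, (W n).1 x, M, fun n => (W n).2.1, fun n => (W n).2.2.1,
    fun n => (W n).2.2.2.1, fun n => (W n).2.2.2.2.1, fun n => (W n).2.2.2.2.2, ?_, htend⟩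
  refine HarmOn.of_local hd fun x hx => ?_
  obtain ⟨ρ, hρ, hρV⟩ := Metric.nhds_basis_closedBall.mem_iff.1 (hV.mem_nhds hx)
  obtain ⟨k, hk⟩ := exists_nat_one_div_lt (half_pos hρ)
  obtain ⟨m, hm⟩ := (TopologicalSpace.denseRange_denseSeq (Euc d)).exists_mem_open
    (isOpen_ball (x := x) (ε := 1 / ((k : ℝ) + 1)))
    ⟨x, mem_ball_self Nat.one_div_pos_of_nat⟩
  set c := TopologicalSpace.denseSeq (Euc d) m
  set s : ℝ := 1 / ((k : ℝ) + 1)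
  have hcV : closedBall c s ⊆ V :=
    (closedBall_subset_closedBall' (by linarith [mem_ball.1 hm])).trans hρV
  have hxc : x ∈ ball c s := mem_ball_comm.1 hm
  let code : ℕ → ℕ := fun j => Nat.pair (Nat.pair m k) j
  have hcode : ∀ j, cen (code j) = c ∧ rad (code j) = s := fun j => by
    simp [cen, rad, code, c, s]
  have hH : HarmOn (fun x => ⨆ n, (W n).1 x) (ball c s) := by
    refine HarmOn.of_tendsto (h := fun j => (W (code j + 1)).1) (M := max M (-L)) isOpen_ball
      (fun j => ?_) (fun j y hy => ?_) fun y hy => ?_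
    · have := hstep2 (code j) (W (code j))
      rw [(hcode j).1, (hcode j).2] at this
      exact this hcV
    · rw [abs_le]
      have h1 := hL y
      have h2 := (W (code j + 1)).2.2.2.1 y
      have h3 := (W (code j + 1)).2.2.2.2.2 y (hcV (ball_subset_closedBall hy))
      exact ⟨by linarith [le_max_right M (-L)], by linarith [le_max_left M (-L)]⟩
    · have hcode' : Tendsto (fun j => code j + 1) atTop atTop :=
        tendsto_atTop_mono (fun j => (Nat.right_le_pair (Nat.pair m k) j).trans
          (Nat.le_succ _)) tendsto_id
      exact (htend y (hcV (ball_subset_closedBall hy))).comp hcode'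
  obtain ⟨ε, hε, hεs⟩ := Metric.mem_nhds_iff.1 (isOpen_ball.mem_nhds hxc)
  exact ⟨ε, hε, hH.mono hεs⟩

/-- Transfer of the integral inequality for a bounded below subharmonic function. -/
theorem SubharmOn.integral_le (hd : 0 < d) {O V : Set (Euc d)} {β δ ω : Measure (Euc d)}
    [IsFiniteMeasure β] [IsFiniteMeasure δ] (hV : IsOpen V) (hVc : IsCompact (closure V))
    (hVO : closure V ⊆ O) (hβV : β Vᶜ = 0) (hδV : δ Vᶜ = 0) (hωV : ω V = 0)
    (hhar : ∀ h, HarmOn h V → ∫ x, h x ∂β = ∫ x, h x ∂δ)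
    (hsbh : ∀ v, SubharmOn v O → Measurable v → (∃ L, ∀ x, L ≤ v x) →
      ∫ x, v x ∂β ≤ ∫ x, v x ∂ω)
    {v : Euc d → ℝ} (hv : SubharmOn v O) (hvm : Measurable v) {L : ℝ} (hL : ∀ x, L ≤ v x) :
    ∫ x, v x ∂δ ≤ ∫ x, v x ∂ω := by
  obtain ⟨w, H, M, hw, hwm, hvw, hwV, hwM, hH, hlim⟩ :=
    hv.exists_seq_tendsto_harmonic hd hvm hL hV hVc hVO
  have haeβ : ∀ᵐ x ∂β, x ∈ V := hβV
  have haeδ : ∀ᵐ x ∂δ, x ∈ V := hδV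
  have haeω : ∀ᵐ x ∂ω, x ∉ V := by
    rw [ae_iff]; simpa using hωV
  have hHv : ∀ x ∈ V, v x ≤ H x := fun x hx =>
    ge_of_tendsto (hlim x hx) (Eventually.of_forall fun n => hvw n x)
  have hHM : ∀ x ∈ V, H x ≤ M := fun x hx =>
    le_of_tendsto (hlim x hx) (Eventually.of_forall fun n => hwM n x hx)
  have hHδ : Integrable H δ := by
    refine Integrable.of_mem_Icc L M ?_ (haeδ.mono fun x hx =>
      ⟨(hL x).trans (hHv x hx), hHM x hx⟩)
    exact aemeasurable_of_tendsto_metrizable_ae atTop (fun n => (hwm n).aemeasurable)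
      (haeδ.mono fun x hx => hlim x hx)
  have hvδ : Integrable v δ := Integrable.of_mem_Icc L M hvm.aemeasurable
    (haeδ.mono fun x hx => ⟨hL x, (hHv x hx).trans (hHM x hx)⟩)
  have h1 : ∫ x, v x ∂δ ≤ ∫ x, H x ∂δ :=
    integral_mono_ae hvδ hHδ (haeδ.mono fun x hx => hHv x hx)
  have h2 : Tendsto (fun n => ∫ x, w n x ∂β) atTop (𝓝 (∫ x, H x ∂β)) := by
    refine tendsto_integral_of_dominated_convergence (fun _ => max M (-L))
      (fun n => (hwm n).aestronglyMeasurable) (integrable_const _)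
      (fun n => haeβ.mono fun x hx => ?_) (haeβ.mono fun x hx => hlim x hx)
    rw [Real.norm_eq_abs, abs_le]
    have h1 := hL x
    have h2 := hvw n x
    have h3 := hwM n x hx
    exact ⟨by linarith [le_max_right M (-L)], by linarith [le_max_left M (-L)]⟩
  have h3 : ∀ n, ∫ x, w n x ∂β ≤ ∫ x, v x ∂ω := fun n => by
    refine (hsbh (w n) (hw n) (hwm n) ⟨L, fun x => (hL x).trans (hvw n x)⟩).trans_eq ?_
    exact integral_congr_ae (haeω.mono fun x hx => hwV n x hx)
  exact h1.trans ((hhar H hH).symm.le.trans (le_of_tendsto' h2 h3))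

end HarmonicMajorant
section ExtendedIntegral

variable {d : ℕ}

lemma erealPos_coe (x : ℝ) : erealPos (x : EReal) = ENNReal.ofReal x := by
  simp [erealPos]

lemma erealPos_bot : erealPos ⊥ = 0 := by simp [erealPos]

lemma erealPos_top : erealPos ⊤ = ⊤ := by simp [erealPos]

lemma erealPos_mono : Monotone erealPos := by
  intro x y hxy
  by_cases hy : y = ⊤
  · simp [hy, erealPos_top]
  by_cases hx : x = ⊥
  · simp [hx, erealPos_bot]
  have hx' : x ≠ ⊤ := ne_top_of_le_ne_top hy hxy
  rw [erealPos, erealPos, if_neg hx', if_neg hy]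
  exact ENNReal.ofReal_le_ofReal (EReal.toReal_le_toReal hxy hx hy)

lemma eInt_mono {μ : Measure (Euc d)} {u v : Euc d → EReal} (h : ∀ᵐ x ∂μ, u x ≤ v x) :
    eInt μ u ≤ eInt μ v := by
  refine EReal.sub_le_sub ?_ ?_
  · exact EReal.coe_ennreal_le_coe_ennreal_iff.2
      (lintegral_mono_ae (h.mono fun x hx => erealPos_mono hx))
  · exact EReal.coe_ennreal_le_coe_ennreal_iff.2
      (lintegral_mono_ae (h.mono fun x hx => erealPos_mono (EReal.neg_le_neg_iff.2 hx)))

lemma eInt_coe {μ : Measure (Euc d)} {v : Euc d → ℝ} (hv : Integrable v μ) :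
    eInt μ (fun x => (v x : EReal)) = ((∫ x, v x ∂μ : ℝ) : EReal) := by
  have hfin : ∀ {f : Euc d → ℝ}, Integrable f μ → ∫⁻ x, ENNReal.ofReal (f x) ∂μ ≠ ⊤ :=
    fun hf => hf.lintegral_lt_top.ne
  have h1 := hfin hv
  have h2 := hfin hv.neg
  simp only [Pi.neg_apply] at h2
  rw [integral_eq_lintegral_pos_part_sub_lintegral_neg_part hv]
  simp only [eInt, ← EReal.coe_neg, erealPos_coe]
  lift ∫⁻ x, ENNReal.ofReal (v x) ∂μ to NNReal using h1 with p
  lift ∫⁻ x, ENNReal.ofReal (-v x) ∂μ to NNReal using h2 with q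
  rw [EReal.coe_sub]
  rfl

end ExtendedIntegral

section Truncation

variable {d : ℕ}

/-- Truncation from below of a subharmonic function. -/
lemma SbhOn.exists_truncation (hd : 0 < d) {u : Euc d → EReal} {O : Set (Euc d)}
    (hO : IsOpen O) (hu : SbhOn u O) (N : ℝ) :
    ∃ v : Euc d → ℝ, SubharmOn v O ∧ Measurable v ∧ (∀ x, -N ≤ v x) ∧
      ∀ x ∈ O, (v x : EReal) = max (u x) (-N : ℝ) := by
  classical
  set v : Euc d → ℝ := fun x => if x ∈ O then (max (u x) (-N : ℝ)).toReal else -N with hvdef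
  have hvO : ∀ x ∈ O, (v x : EReal) = max (u x) (-N : ℝ) := by
    intro x hx
    simp only [hvdef, if_pos hx]
    refine EReal.coe_toReal (max_lt (hu.2.1 x hx) (EReal.coe_lt_top _)).ne ?_
    exact ((EReal.bot_lt_coe _).trans_le (le_max_right _ _)).ne'
  have hN : ∀ x, -N ≤ v x := by
    intro x
    by_cases hx : x ∈ O
    · rw [← EReal.coe_le_coe_iff, hvO x hx]; exact le_max_right _ _
    · simp [hvdef, hx]
  have husc : UpperSemicontinuousOn v O := by
    intro x hx y hy
    have h1 : max (u x) (-N : ℝ) < (y : EReal) := by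
      rw [← hvO x hx]; exact EReal.coe_lt_coe_iff.2 hy
    have h2 := hu.1 x hx y ((le_max_left _ _).trans_lt h1)
    filter_upwards [h2, self_mem_nhdsWithin] with z hz hzO
    rw [← EReal.coe_lt_coe_iff, hvO z hzO]
    exact max_lt hz ((le_max_right _ _).trans_lt h1)
  refine ⟨v, ⟨husc, ?_⟩, ?_, hN, hvO⟩
  · intro x r hr hx h hc hh hb y hy
    rw [← EReal.coe_le_coe_iff, hvO y (hx hy)]
    refine max_le (hu.2.2 x r hr hx h hc hh (fun z hz => ?_) y hy) (EReal.coe_le_coe ?_)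
    · refine le_trans ?_ (EReal.coe_le_coe (hb z hz))
      rw [hvO z (hx (sphere_subset_closedBall hz))]
      exact le_max_left _ _
    · exact (harmOn_const (-N) _).le_on_closedBall hd hr continuousOn_const hc hh
        (fun z hz => (hN z).trans (hb z hz)) y hy
  · refine measurable_of_Iio fun a => ?_
    by_cases ha : a ≤ -N
    · convert MeasurableSet.empty
      ext x
      simpa using ha.trans (hN x)
    · have h1 : v ⁻¹' Iio a = Oᶜ ∪ (O ∩ v ⁻¹' Iio a) := by
        ext x
        by_cases hx : x ∈ O
        · simp [hx]
        · simpa [hx, hvdef] using ha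
      have h2 : IsOpen (O ∩ v ⁻¹' Iio a) := by
        rw [isOpen_iff_mem_nhds]
        rintro x ⟨hx, hxa⟩
        have := husc x hx a hxa
        rw [hO.nhdsWithin_eq hx] at this
        exact inter_mem (hO.mem_nhds hx) this
      rw [h1]
      exact hO.measurableSet.compl.union h2.measurableSet

/-- A domination between truncations passes to the subharmonic function itself. -/
lemma le_eInt_of_le_eInt_truncation {O : Set (Euc d)} {ω : Measure (Euc d)} {u : Euc d → EReal}
    (hωO : ∀ᵐ x ∂ω, x ∈ O) {v : ℕ → Euc d → ℝ} (hvm : ∀ N, Measurable (v N))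
    (hv : ∀ N : ℕ, ∀ x ∈ O, (v N x : EReal) = max (u x) ((-(N : ℝ) : ℝ) : EReal))
    (hint : Integrable (v 0) ω) {a : EReal}
    (ha : ∀ N, a ≤ eInt ω (fun x => (v N x : EReal))) : a ≤ eInt ω u := by
  have hpos : ∀ N, ∀ᵐ x ∂ω, erealPos (v N x : EReal) = erealPos (u x) := fun N => by
    filter_upwards [hωO] with x hx
    rw [hv N x hx, erealPos_mono.map_max, erealPos_coe, ENNReal.ofReal_of_nonpos (by simp),
      max_eq_left (by simp)]
  have hP : ∀ N, ∫⁻ x, erealPos (v N x : EReal) ∂ω = ∫⁻ x, erealPos (u x) ∂ω := fun N =>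
    lintegral_congr_ae (hpos N)
  have hPfin : ∫⁻ x, erealPos (u x) ∂ω ≠ ⊤ := by
    rw [← hP 0]
    simp only [erealPos_coe]
    exact hint.lintegral_lt_top.ne
  have hn : Tendsto (fun N => ∫⁻ x, erealPos (-(v N x : EReal)) ∂ω) atTop
      (𝓝 (∫⁻ x, erealPos (-(u x)) ∂ω)) := by
    refine lintegral_tendsto_of_tendsto_of_monotone (fun N => ?_) ?_ ?_
    · simp only [← EReal.coe_neg, erealPos_coe]
      exact (hvm N).neg.ennreal_ofReal.aemeasurable
    · filter_upwards [hωO] with x hx m n hmn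
      refine erealPos_mono (EReal.neg_le_neg_iff.2 ?_)
      rw [hv m x hx, hv n x hx]
      refine max_le_max le_rfl (EReal.coe_le_coe (neg_le_neg ?_))
      exact_mod_cast hmn
    · filter_upwards [hωO] with x hx
      simp only [hv _ x hx]
      induction u x with
      | bot =>
        simp only [bot_le, max_eq_right, ← EReal.coe_neg, neg_neg, erealPos_coe, EReal.neg_bot,
          erealPos_top, ENNReal.ofReal_natCast]
        exact ENNReal.tendsto_nat_nhds_top
      | coe y =>
        obtain ⟨n, hn⟩ := exists_nat_gt (-y)
        refine tendsto_const_nhds.congr' ?_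
        filter_upwards [eventually_ge_atTop n] with m hm
        rw [max_eq_left]
        refine EReal.coe_le_coe ?_
        have : (n : ℝ) ≤ m := by exact_mod_cast hm
        linarith
      | top => simp [erealPos_bot]
  have hlim : Tendsto (fun N => eInt ω (fun x => (v N x : EReal))) atTop (𝓝 (eInt ω u)) := by
    simp only [eInt, hP]
    lift ∫⁻ x, erealPos (u x) ∂ω to NNReal using hPfin with p
    simp only [sub_eq_add_neg]
    have h1 := (continuous_coe_ennreal_ereal.tendsto _).comp hn
    have h2 := (continuous_neg.tendsto _).comp h1
    refine (EReal.continuousAt_add (p := ((p : ℝ≥0∞), _)) (Or.inl ?_) (Or.inl ?_)).tendsto.comp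
      (tendsto_const_nhds.prodMk_nhds h2)
    all_goals simp
  exact ge_of_tendsto' hlim ha

end Truncation

/-- The radial profile, as a function of the squared norm, of the fundamental solution of the
Laplacian, up to a multiplicative constant. -/
def fundSol (d : ℕ) (s : ℝ) : ℝ :=
  if d = 2 then Real.log s else s ^ (1 - (d : ℝ) / 2) / (1 - (d : ℝ) / 2)

lemma hasDerivAt_fundSol (d : ℕ) {s : ℝ} (hs : 0 < s) :
    HasDerivAt (fundSol d) (s ^ (-((d : ℝ) / 2))) s := by
  by_cases h : d = 2
  · have : fundSol d = Real.log := by ext; simp [fundSol, h]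
    rw [this]
    refine (Real.hasDerivAt_log hs.ne').congr_deriv ?_
    rw [h]; norm_num [Real.rpow_neg hs.le]
  · have hne : 1 - (d : ℝ) / 2 ≠ 0 := by
      intro h0
      apply h
      have : (d : ℝ) = 2 := by linarith
      exact_mod_cast this
    have : fundSol d = fun s => s ^ (1 - (d : ℝ) / 2) / (1 - (d : ℝ) / 2) := by
      ext; simp [fundSol, h]
    rw [this]
    refine ((Real.hasDerivAt_rpow_const (p := 1 - (d : ℝ) / 2) (Or.inl hs.ne')).div_const
      (1 - (d : ℝ) / 2)).congr_deriv ?_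
    rw [mul_div_cancel_left₀ _ hne]
    congr 1; ring

/-- A smooth truncation near zero of the derivative of the profile `fundSol`. -/
def truncDeriv (d : ℕ) (e s : ℝ) : ℝ :=
  Real.smoothTransition (2 * s / e - 1) * s ^ (-((d : ℝ) / 2))

lemma truncDeriv_of_le {d : ℕ} {e s : ℝ} (he : 0 < e) (hs : s ≤ e / 2) : truncDeriv d e s = 0 := by
  rw [truncDeriv, Real.smoothTransition.zero_of_nonpos, zero_mul]
  rw [sub_nonpos, div_le_one he]; linarith

lemma truncDeriv_of_ge {d : ℕ} {e s : ℝ} (he : 0 < e) (hs : e ≤ s) :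
    truncDeriv d e s = s ^ (-((d : ℝ) / 2)) := by
  rw [truncDeriv, Real.smoothTransition.one_of_one_le, one_mul]
  rw [le_sub_iff_add_le, le_div_iff₀ he]; linarith

lemma truncDeriv_nonneg {d : ℕ} {e s : ℝ} (he : 0 < e) : 0 ≤ truncDeriv d e s := by
  rcases le_total s (e / 2) with h | h
  · rw [truncDeriv_of_le he h]
  · exact mul_nonneg (Real.smoothTransition.nonneg _) (Real.rpow_nonneg (by linarith) _)

lemma contDiff_truncDeriv (d : ℕ) {e : ℝ} (he : 0 < e) : ContDiff ℝ 1 (truncDeriv d e) := by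
  rw [contDiff_iff_contDiffAt]
  intro s
  rcases lt_or_ge s (e / 2) with h | h
  · refine (contDiffAt_const (c := (0 : ℝ))).congr_of_eventuallyEq ?_
    filter_upwards [Iio_mem_nhds h] with t ht
    exact truncDeriv_of_le he (le_of_lt ht)
  · refine ContDiffAt.mul ?_ ?_
    · exact (Real.smoothTransition.contDiff.contDiffAt (n := 1)).comp s (by fun_prop)
    · exact Real.contDiffAt_rpow_const_of_ne (by linarith)

/-- The fundamental solution with its singularity smoothed out inside `{‖x‖ ^ 2 < e}`. -/
def truncSol (d : ℕ) (e : ℝ) (x : Euc d) : ℝ := ∫ s in (0 : ℝ)..‖x‖ ^ 2, truncDeriv d e s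

lemma hasDerivAt_integral_truncDeriv (d : ℕ) {e : ℝ} (he : 0 < e) (s : ℝ) :
    HasDerivAt (fun t => ∫ s in (0 : ℝ)..t, truncDeriv d e s) (truncDeriv d e s) s :=
  intervalIntegral.integral_hasDerivAt_right
    ((contDiff_truncDeriv d he).continuous.intervalIntegrable _ _)
    ((contDiff_truncDeriv d he).continuous.stronglyMeasurableAtFilter _ _)
    (contDiff_truncDeriv d he).continuous.continuousAt

lemma contDiff_integral_truncDeriv (d : ℕ) {e : ℝ} (he : 0 < e) :
    ContDiff ℝ 2 (fun t => ∫ s in (0 : ℝ)..t, truncDeriv d e s) := by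
  have h2 : (2 : WithTop ℕ∞) = 1 + 1 := by norm_num
  rw [h2, contDiff_succ_iff_deriv]
  refine ⟨fun s => (hasDerivAt_integral_truncDeriv d he s).differentiableAt, by simp, ?_⟩
  have : deriv (fun t => ∫ s in (0 : ℝ)..t, truncDeriv d e s) = truncDeriv d e :=
    funext fun s => (hasDerivAt_integral_truncDeriv d he s).deriv
  rw [this]
  exact contDiff_truncDeriv d he

lemma contDiff_truncSol (d : ℕ) {e : ℝ} (he : 0 < e) : ContDiff ℝ 2 (truncSol d e) :=
  (contDiff_integral_truncDeriv d he).comp (contDiff_norm_sq ℝ)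

lemma coordLaplacian_comp_norm_sq {d : ℕ} {η k : ℝ → ℝ} (hη : ∀ s, HasDerivAt η (k s) s)
    (hk : Differentiable ℝ k) (x : Euc d) :
    coordLaplacian (fun y : Euc d => η (‖y‖ ^ 2)) x =
      4 * ‖x‖ ^ 2 * deriv k (‖x‖ ^ 2) + 2 * d * k (‖x‖ ^ 2) := by
  have h1 : ∀ (y : Euc d) (i : Fin d),
      fderiv ℝ (fun y : Euc d => η (‖y‖ ^ 2)) y (EuclideanSpace.single i (1 : ℝ)) =
        k (‖y‖ ^ 2) * (2 * y i) := by
    intro y i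
    have := (hη (‖y‖ ^ 2)).comp_hasFDerivAt y (hasStrictFDerivAt_norm_sq y).hasFDerivAt
    rw [HasFDerivAt.fderiv (f := fun y : Euc d => η (‖y‖ ^ 2)) this]
    simp [EuclideanSpace.inner_single_right]
  have h2 : ∀ i : Fin d, fderiv ℝ (fun y : Euc d => k (‖y‖ ^ 2) * (2 * y i)) x
      (EuclideanSpace.single i (1 : ℝ)) =
        deriv k (‖x‖ ^ 2) * (2 * x i) * (2 * x i) + k (‖x‖ ^ 2) * 2 := by
    intro i
    have ha := ((hk (‖x‖ ^ 2)).hasDerivAt).comp_hasFDerivAt x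
      (hasStrictFDerivAt_norm_sq x).hasFDerivAt
    have hb : HasFDerivAt (fun y : Euc d => 2 * y i)
        ((2 : ℝ) • (EuclideanSpace.proj i : Euc d →L[ℝ] ℝ)) x :=
      ((EuclideanSpace.proj i : Euc d →L[ℝ] ℝ).hasFDerivAt).const_mul 2
    have := ha.mul hb
    rw [HasFDerivAt.fderiv (f := fun y : Euc d => k (‖y‖ ^ 2) * (2 * y i)) this]
    simp [EuclideanSpace.inner_single_right]
    ring
  unfold coordLaplacian
  simp_rw [h1, h2]
  rw [Finset.sum_add_distrib, EuclideanSpace.norm_sq_eq]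
  simp only [Finset.sum_const, Finset.card_univ, Fintype.card_fin, nsmul_eq_mul, Real.norm_eq_abs,
    sq_abs]
  rw [Finset.mul_sum, Finset.sum_mul]
  congr 1
  · exact Finset.sum_congr rfl fun i _ => by ring
  · ring

lemma coordLaplacian_truncSol {d : ℕ} {e : ℝ} (he : 0 < e) (x : Euc d) :
    coordLaplacian (truncSol d e) x =
      4 * ‖x‖ ^ 2 * deriv (truncDeriv d e) (‖x‖ ^ 2) + 2 * d * truncDeriv d e (‖x‖ ^ 2) :=
  coordLaplacian_comp_norm_sq (hasDerivAt_integral_truncDeriv d he)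
    ((contDiff_truncDeriv d he).differentiable (by simp)) x

lemma coordLaplacian_truncSol_nonneg {d : ℕ} {e : ℝ} (he : 0 < e) (x : Euc d) :
    0 ≤ coordLaplacian (truncSol d e) x := by
  rw [coordLaplacian_truncSol he]
  rcases (sq_nonneg ‖x‖).eq_or_lt with h0 | h0
  · rw [← h0, truncDeriv_of_le he (by linarith)]; simp
  set s := ‖x‖ ^ 2
  have hθ : DifferentiableAt ℝ (fun s => Real.smoothTransition (2 * s / e - 1)) s :=
    ((Real.smoothTransition.contDiff (n := 1)).differentiable (by simp) _).comp s (by fun_prop)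
  have hmono : Monotone fun s => Real.smoothTransition (2 * s / e - 1) := fun a b hab =>
    Real.smoothTransition.monotone (by gcongr)
  have hd : deriv (truncDeriv d e) s =
      deriv (fun s => Real.smoothTransition (2 * s / e - 1)) s * s ^ (-((d : ℝ) / 2)) +
      Real.smoothTransition (2 * s / e - 1) *
        (-((d : ℝ) / 2) * s ^ (-((d : ℝ) / 2) - 1)) :=
    (hθ.hasDerivAt.mul (Real.hasDerivAt_rpow_const (Or.inl h0.ne'))).deriv
  have hp : s * s ^ (-((d : ℝ) / 2) - 1) = s ^ (-((d : ℝ) / 2)) := by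
    rw [Real.rpow_sub_one h0.ne']; field_simp
  have : 4 * s * deriv (truncDeriv d e) s + 2 * d * truncDeriv d e s =
      4 * s * (deriv (fun s => Real.smoothTransition (2 * s / e - 1)) s *
        s ^ (-((d : ℝ) / 2))) := by
    rw [hd, truncDeriv, ← hp]; ring
  rw [this]
  have := hmono.deriv_nonneg (x := s)
  positivity

lemma coordLaplacian_truncSol_eq_zero {d : ℕ} {e : ℝ} (he : 0 < e) {x : Euc d}
    (hx : e < ‖x‖ ^ 2) : coordLaplacian (truncSol d e) x = 0 := by
  rw [coordLaplacian_truncSol he]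
  set s := ‖x‖ ^ 2
  have h0 : 0 < s := he.trans hx
  have hev : truncDeriv d e =ᶠ[𝓝 s] fun s => s ^ (-((d : ℝ) / 2)) := by
    filter_upwards [Ioi_mem_nhds hx] with t ht using truncDeriv_of_ge he (le_of_lt ht)
  rw [hev.deriv_eq, (Real.hasDerivAt_rpow_const (Or.inl h0.ne')).deriv, hev.eq_of_nhds,
    Real.rpow_sub_one h0.ne']
  field_simp
  ring

lemma truncSol_eq_fundSol_add {d : ℕ} {e : ℝ} (he : 0 < e) :
    ∃ c, ∀ x : Euc d, e ≤ ‖x‖ ^ 2 → truncSol d e x = fundSol d (‖x‖ ^ 2) + c := by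
  refine ⟨(∫ s in (0 : ℝ)..e, truncDeriv d e s) - fundSol d e, fun x hx => ?_⟩
  have hi : ∀ a b, IntervalIntegrable (truncDeriv d e) volume a b := fun a b =>
    (contDiff_truncDeriv d he).continuous.intervalIntegrable _ _
  rw [truncSol, ← intervalIntegral.integral_add_adjacent_intervals (hi 0 e) (hi e _),
    intervalIntegral.integral_eq_sub_of_hasDerivAt (f := fundSol d) (a := e) (b := ‖x‖ ^ 2) _
      (hi _ _)]
  · ring
  · intro s hs
    rw [uIcc_of_le hx] at hs
    rw [truncDeriv_of_ge he hs.1]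
    exact hasDerivAt_fundSol d (he.trans_le hs.1)

lemma truncSol_nonneg {d : ℕ} {e : ℝ} (he : 0 < e) (x : Euc d) : 0 ≤ truncSol d e x :=
  intervalIntegral.integral_nonneg (sq_nonneg _) fun _ _ => truncDeriv_nonneg he

lemma truncSol_zero (d : ℕ) (e : ℝ) : truncSol d e 0 = 0 := by simp [truncSol]

lemma truncSol_pos {d : ℕ} {e : ℝ} (he : 0 < e) {x : Euc d} (hx : e ≤ ‖x‖ ^ 2) :
    0 < truncSol d e x := by
  refine intervalIntegral.integral_pos (he.trans_le hx)
    (contDiff_truncDeriv d he).continuous.continuousOn (fun _ _ => truncDeriv_nonneg he)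
    ⟨‖x‖ ^ 2, ⟨sq_nonneg _, le_rfl⟩, ?_⟩
  rw [truncDeriv_of_ge he hx]
  exact Real.rpow_pos_of_pos (he.trans_le hx) _

lemma continuousOn_fundSol_norm_sq (d : ℕ) :
    ContinuousOn (fun x : Euc d => fundSol d (‖x‖ ^ 2)) {0}ᶜ := by
  intro x hx
  have h0 : 0 < ‖x‖ ^ 2 := pow_pos (norm_pos_iff.2 hx) 2
  exact ((hasDerivAt_fundSol d h0).continuousAt.comp (f := fun x : Euc d => ‖x‖ ^ 2)
    (by fun_prop)).continuousWithinAt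

/-- The fundamental solution of the Laplacian is harmonic away from the origin. -/
theorem harmOn_fundSol (d : ℕ) : HarmOn (fun x : Euc d => fundSol d (‖x‖ ^ 2)) {0}ᶜ := by
  refine ⟨continuousOn_fundSol_norm_sq d, fun x r hr hsub => ?_⟩
  have hx : r < ‖x‖ := by
    by_contra! h
    exact hsub (mem_closedBall.2 (by simpa using h)) rfl
  set e := (‖x‖ - r) ^ 2 / 2
  have hp : 0 < (‖x‖ - r) ^ 2 := pow_pos (sub_pos.2 hx) 2
  have he : 0 < e := half_pos hp
  have hball : ∀ y ∈ closedBall x r, e < ‖y‖ ^ 2 := fun y hy => by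
    have h1 : ‖x‖ - r ≤ ‖y‖ := by
      have := norm_sub_norm_le x y
      rw [← dist_eq_norm, dist_comm] at this
      linarith [mem_closedBall.1 hy]
    have h2 : (‖x‖ - r) ^ 2 ≤ ‖y‖ ^ 2 := pow_le_pow_left₀ (by linarith) h1 2
    have h3 : e < (‖x‖ - r) ^ 2 := half_lt_self hp
    linarith
  obtain ⟨c, hc⟩ := truncSol_eq_fundSol_add (d := d) he
  have hm := eq_setAverage_of_coordLaplacian_eq_zero (contDiff_truncSol d he) (x := x) hr
    fun y hy => coordLaplacian_truncSol_eq_zero he (hball y hy)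
  have hmc : HarmOn (fun _ : Euc d => c) univ := harmOn_const c univ
  rw [eq_setAverage_closedBall_iff hr] at hm ⊢
  have hcc := (eq_setAverage_closedBall_iff hr).1 (hmc.2 x r hr (subset_univ _))
  have hcongr : ∫ y in closedBall x r, fundSol d (‖y‖ ^ 2) =
      ∫ y in closedBall x r, (truncSol d e y - c) :=
    setIntegral_congr_fun measurableSet_closedBall fun y hy => by
      simp only [hc y (hball y hy).le]; ring
  have hx0 := hc x (hball x (mem_closedBall_self hr.le)).le
  rw [hcongr, integral_sub, hm, hcc, ← mul_sub, hx0]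
  · ring_nf
  · exact (contDiff_truncSol d he).continuous.continuousOn.integrableOn_compact
      (isCompact_closedBall x r)
  · exact integrableOn_const (measure_closedBall_lt_top.ne)

/-- The holomorphic extension of `fundSol` to the slit plane. -/
def fundSolC (d : ℕ) (z : ℂ) : ℂ :=
  if d = 2 then Complex.log z
  else z ^ ((1 - (d : ℝ) / 2 : ℝ) : ℂ) / ((1 - (d : ℝ) / 2 : ℝ) : ℂ)

lemma differentiableAt_fundSolC (d : ℕ) {z : ℂ} (hz : z ∈ Complex.slitPlane) :
    DifferentiableAt ℂ (fundSolC d) z := by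
  by_cases h : d = 2
  · have : fundSolC d = Complex.log := by ext; simp [fundSolC, h]
    rw [this]
    exact Complex.differentiableAt_log hz
  · have : fundSolC d =
        fun z => z ^ ((1 - (d : ℝ) / 2 : ℝ) : ℂ) / ((1 - (d : ℝ) / 2 : ℝ) : ℂ) := by
      ext; simp [fundSolC, h]
    rw [this]
    exact (differentiableAt_id.cpow_const hz).div_const _

lemma fundSolC_ofReal (d : ℕ) {s : ℝ} (hs : 0 < s) : fundSolC d (s : ℂ) = (fundSol d s : ℂ) := by
  by_cases h : d = 2
  · simp [fundSolC, fundSol, h, Complex.ofReal_log hs.le]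
  · simp only [fundSolC, fundSol, h, if_false]
    rw [Complex.ofReal_div, Complex.ofReal_cpow hs.le]

/-- The holomorphic extension in `t` of `‖w - t • v‖ ^ 2`. -/
def lineSq {d : ℕ} (v w : Euc d) (ζ : ℂ) : ℂ :=
  (‖w‖ ^ 2 : ℝ) - 2 * ζ * (inner ℝ w v : ℝ) + ζ ^ 2 * (‖v‖ ^ 2 : ℝ)

lemma lineSq_ofReal {d : ℕ} (v w : Euc d) (t : ℝ) :
    lineSq v w (t : ℂ) = ((‖w - t • v‖ ^ 2 : ℝ) : ℂ) := by
  rw [norm_sub_sq_real, norm_smul, inner_smul_right, lineSq, mul_pow, Real.norm_eq_abs, sq_abs]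
  push_cast
  ring

lemma re_lineSq_pos {d : ℕ} {v w : Euc d} (hv : ‖v‖ ≤ 1) (hw : w ≠ 0) {ζ : ℂ}
    (hζ : ‖ζ‖ ≤ ‖w‖ / 4) : 0 < (lineSq v w ζ).re := by
  have hw0 : 0 < ‖w‖ := norm_pos_iff.2 hw
  have h1 : ‖2 * ζ * ((inner ℝ w v : ℝ) : ℂ)‖ ≤ 2 * (‖w‖ / 4) * (‖w‖ * 1) := by
    rw [norm_mul, norm_mul, Complex.norm_real, Complex.norm_ofNat]
    have := (norm_inner_le_norm (𝕜 := ℝ) w v).trans (mul_le_mul_of_nonneg_left hv hw0.le)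
    gcongr
  have h2 : ‖ζ ^ 2 * ((‖v‖ ^ 2 : ℝ) : ℂ)‖ ≤ (‖w‖ / 4) ^ 2 * 1 ^ 2 := by
    rw [norm_mul, norm_pow, Complex.norm_real, Real.norm_of_nonneg (sq_nonneg _)]
    gcongr
  have h3 := (Complex.abs_re_le_norm _).trans h1
  have h4 := (Complex.abs_re_le_norm _).trans h2
  rw [lineSq, Complex.add_re, Complex.sub_re, Complex.ofReal_re]
  nlinarith [abs_le.1 h3, abs_le.1 h4]

lemma lineSq_mem_slitPlane {d : ℕ} {v w : Euc d} (hv : ‖v‖ ≤ 1) (hw : w ≠ 0) {ζ : ℂ}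
    (hζ : ‖ζ‖ ≤ ‖w‖ / 4) : lineSq v w ζ ∈ Complex.slitPlane :=
  Or.inl (re_lineSq_pos hv hw hζ)

/-- The coefficients of the Taylor expansion of the fundamental solution along a line. -/
def taylorCoeff {d : ℕ} (k : ℕ) (v w : Euc d) : ℝ :=
  (cauchyPowerSeries (fun ζ => fundSolC d (lineSq v w ζ)) 0 (‖w‖ / 4) k fun _ => 1).re

lemma differentiableOn_fundSolC_lineSq {d : ℕ} {v w : Euc d} (hv : ‖v‖ ≤ 1) (hw : w ≠ 0) :
    DifferentiableOn ℂ (fun ζ => fundSolC d (lineSq v w ζ)) (closedBall 0 (‖w‖ / 4)) := by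
  intro ζ hζ
  have := differentiableAt_fundSolC d (lineSq_mem_slitPlane hv hw (by simpa using hζ))
  refine (this.comp ζ ?_).differentiableWithinAt
  unfold lineSq
  fun_prop

lemma hasSum_taylorCoeff {d : ℕ} {v w : Euc d} (hv : ‖v‖ ≤ 1) {t : ℝ}
    (ht : |t| < ‖w‖ / 4) :
    HasSum (fun k => t ^ k * taylorCoeff k v w) (fundSol d (‖w - t • v‖ ^ 2)) := by
  have hw0 : 0 < ‖w‖ := by linarith [abs_nonneg t]
  have hw : w ≠ 0 := norm_pos_iff.1 hw0
  have hR : 0 < ‖w‖ / 4 := by linarith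
  have hs := (DifferentiableOn.hasFPowerSeriesOnBall (R := .mk (‖w‖ / 4) hR.le)
    (differentiableOn_fundSolC_lineSq hv hw) hR).hasSum (y := (t : ℂ)) (by
      rw [Metric.mem_eball, edist_zero_right, ← ofReal_norm, Complex.norm_real]
      rw [← ENNReal.ofReal_coe_nnreal]
      exact (ENNReal.ofReal_lt_ofReal_iff hR).2 ht)
  have hpos : 0 < ‖w - t • v‖ ^ 2 := by
    have := re_lineSq_pos hv hw (ζ := (t : ℂ)) (by rw [Complex.norm_real]; exact ht.le)
    rwa [lineSq_ofReal, Complex.ofReal_re] at this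
  rw [zero_add, lineSq_ofReal, fundSolC_ofReal d hpos] at hs
  have hre := Complex.hasSum_re hs
  rw [Complex.ofReal_re] at hre
  refine hre.congr_fun fun k => ?_
  rw [FormalMultilinearSeries.apply_eq_pow_smul_coeff, smul_eq_mul, ← Complex.ofReal_pow,
    Complex.re_ofReal_mul]
  rfl

lemma norm_circleMap_zero_le {d : ℕ} (w : Euc d) (θ : ℝ) :
    ‖circleMap 0 (‖w‖ / 4) θ‖ ≤ ‖w‖ / 4 := by
  rw [norm_circleMap_zero, abs_of_nonneg (by positivity)]

lemma abs_taylorCoeff_le {d : ℕ} {v : Euc d} (hv : ‖v‖ ≤ 1) {ρ : ℝ} (hρ : 0 < ρ) (R : ℝ) :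
    ∃ M, ∀ w : Euc d, ρ ≤ ‖w‖ → ‖w‖ ≤ R → ∀ k, |taylorCoeff k v w| ≤ M * (4 / ρ) ^ k := by
  set T : Set (Euc d × ℂ) := {p | ρ ≤ ‖p.1‖ ∧ ‖p.1‖ ≤ R ∧ ‖p.2‖ ≤ ‖p.1‖ / 4}
  have hT : IsCompact T := by
    have hcl : IsClosed T := by
      have h1 : Continuous fun p : Euc d × ℂ => ‖p.1‖ := by fun_prop
      have h2 : Continuous fun p : Euc d × ℂ => ‖p.2‖ := by fun_prop
      exact (isClosed_le continuous_const h1).inter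
        ((isClosed_le h1 continuous_const).inter (isClosed_le h2 (h1.div_const 4)))
    refine ((isCompact_closedBall (0 : Euc d) R).prod
      (isCompact_closedBall (0 : ℂ) (R / 4))).of_isClosed_subset hcl fun p hp => ?_
    simp only [mem_prod, mem_closedBall, dist_zero_right]
    exact ⟨hp.2.1, by linarith [hp.2.1, hp.2.2]⟩
  have hc : ContinuousOn (fun p : Euc d × ℂ => fundSolC d (lineSq v p.1 p.2)) T := by
    intro p hp
    have hw : p.1 ≠ 0 := norm_pos_iff.1 (hρ.trans_le hp.1)
    have := (differentiableAt_fundSolC d (lineSq_mem_slitPlane hv hw hp.2.2)).continuousAt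
    refine (ContinuousAt.comp (f := fun p : Euc d × ℂ => lineSq v p.1 p.2) this
      ?_).continuousWithinAt
    unfold lineSq
    fun_prop
  obtain ⟨M, hM⟩ := hT.exists_bound_of_continuousOn hc
  refine ⟨max M 0, fun w hw1 hw2 k => ?_⟩
  have hw0 : 0 < ‖w‖ := hρ.trans_le hw1
  have hcm := norm_circleMap_zero_le w
  have h1 : |taylorCoeff k v w| ≤
      ‖cauchyPowerSeries (fun ζ => fundSolC d (lineSq v w ζ)) 0 (‖w‖ / 4) k‖ := by
    refine (Complex.abs_re_le_norm _).trans ((ContinuousMultilinearMap.le_opNorm _ _).trans ?_)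
    simp
  refine h1.trans ((norm_cauchyPowerSeries_le _ _ _ _).trans ?_)
  gcongr ?_ * ?_ ^ k
  · have h2 : ∫ θ : ℝ in 0..2 * Real.pi, ‖fundSolC d (lineSq v w (circleMap 0 (‖w‖ / 4) θ))‖ ≤
        ∫ θ : ℝ in 0..2 * Real.pi, max M 0 := by
      refine intervalIntegral.integral_mono_on Real.two_pi_pos.le ?_ (by simp) ?_
      · refine Continuous.intervalIntegrable (Continuous.norm ?_) _ _
        exact (differentiableOn_fundSolC_lineSq hv
          (norm_pos_iff.1 hw0)).continuousOn.comp_continuous (continuous_circleMap _ _) fun θ =>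
            mem_closedBall_zero_iff.2 (hcm θ)
      · intro θ _
        exact (hM (w, circleMap 0 (‖w‖ / 4) θ) ⟨hw1, hw2, hcm θ⟩).trans (le_max_left _ _)
    have := Real.two_pi_pos
    refine (mul_le_mul_of_nonneg_left h2 (by positivity)).trans_eq ?_
    simp
    field_simp
  · rw [abs_of_pos (by positivity), inv_div]
    gcongr

lemma continuousOn_taylorCoeff {d : ℕ} {v : Euc d} (hv : ‖v‖ ≤ 1) (k : ℕ) :
    ContinuousOn (taylorCoeff k v) {0}ᶜ := by
  rw [continuousOn_iff_continuous_domRestrict]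
  have key : Continuous fun w : ({0}ᶜ : Set (Euc d)) =>
      ∫ θ in 0..2 * Real.pi, deriv (circleMap 0 (‖(w : Euc d)‖ / 4)) θ •
        ((1 / (circleMap 0 (‖(w : Euc d)‖ / 4) θ - 0)) ^ k •
          (circleMap 0 (‖(w : Euc d)‖ / 4) θ - 0)⁻¹ •
          fundSolC d (lineSq v (w : Euc d) (circleMap 0 (‖(w : Euc d)‖ / 4) θ))) := by
    refine intervalIntegral.continuous_parametric_intervalIntegral_of_continuous' ?_ _ _
    have hcirc : Continuous fun p : ({0}ᶜ : Set (Euc d)) × ℝ =>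
        circleMap 0 (‖(p.1 : Euc d)‖ / 4) p.2 := by
      unfold circleMap
      fun_prop
    have hne : ∀ p : ({0}ᶜ : Set (Euc d)) × ℝ,
        circleMap 0 (‖(p.1 : Euc d)‖ / 4) p.2 - 0 ≠ 0 := fun p => by
      rw [sub_zero]
      have : 0 < ‖(p.1 : Euc d)‖ := norm_pos_iff.2 p.1.2
      exact circleMap_ne_center (by positivity)
    have hG : Continuous fun p : ({0}ᶜ : Set (Euc d)) × ℝ =>
        fundSolC d (lineSq v (p.1 : Euc d) (circleMap 0 (‖(p.1 : Euc d)‖ / 4) p.2)) := by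
      rw [continuous_iff_continuousAt]
      intro p
      have := (differentiableAt_fundSolC d (lineSq_mem_slitPlane hv p.1.2
        (norm_circleMap_zero_le (p.1 : Euc d) p.2))).continuousAt
      refine ContinuousAt.comp (f := fun p : ({0}ᶜ : Set (Euc d)) × ℝ =>
        lineSq v (p.1 : Euc d) (circleMap 0 (‖(p.1 : Euc d)‖ / 4) p.2)) this ?_
      refine Continuous.continuousAt ?_
      unfold lineSq
      fun_prop
    have hinv : Continuous fun p : ({0}ᶜ : Set (Euc d)) × ℝ =>
        (circleMap 0 (‖(p.1 : Euc d)‖ / 4) p.2 - 0)⁻¹ := (hcirc.sub continuous_const).inv₀ hne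
    simp only [Function.uncurry_def, deriv_circleMap, one_div]
    exact (hcirc.mul continuous_const).smul ((hinv.pow k).smul (hinv.smul hG))
  have h := Complex.continuous_re.comp (key.const_smul ((2 * Real.pi * Complex.I : ℂ)⁻¹))
  refine h.congr fun w => ?_
  simp only [taylorCoeff, domRestrict_apply, cauchyPowerSeries_apply, circleIntegral,
    Function.comp_apply]
  rfl

lemma hasSum_integral_taylorCoeff {d : ℕ} {μ : Measure (Euc d)} [IsFiniteMeasure μ]
    {z v : Euc d} {ρ R : ℝ} (hρ : 0 < ρ) (hμ : ∀ᵐ x ∂μ, ρ ≤ ‖x - z‖ ∧ ‖x - z‖ ≤ R)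
    (hv : ‖v‖ ≤ 1) {t : ℝ} (ht : |t| < ρ / 4) :
    HasSum (fun k => t ^ k * ∫ x, taylorCoeff k v (x - z) ∂μ)
      (∫ x, fundSol d (‖x - (z + t • v)‖ ^ 2) ∂μ) := by
  obtain ⟨M, hM⟩ := abs_taylorCoeff_le hv hρ R
  have hmeas : ∀ k, AEStronglyMeasurable (fun x => taylorCoeff k v (x - z)) μ := fun k => by
    have hne : ∀ᵐ x ∂μ, x ∈ ({z}ᶜ : Set (Euc d)) := by
      filter_upwards [hμ] with x hx hxz
      rw [mem_singleton_iff.1 hxz, sub_self, norm_zero] at hx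
      linarith [hx.1]
    rw [← Measure.restrict_eq_self_of_ae_mem hne]
    refine ContinuousOn.aestronglyMeasurable ?_ (measurableSet_singleton z).compl
    exact (continuousOn_taylorCoeff hv k).comp (by fun_prop) fun x hx => by
      simpa [sub_eq_zero] using hx
  have hbound : ∀ k, ∀ᵐ x ∂μ,
      ‖t ^ k * taylorCoeff k v (x - z)‖ ≤ M * (|t| * (4 / ρ)) ^ k := fun k => by
    filter_upwards [hμ] with x hx
    rw [norm_mul, norm_pow, Real.norm_eq_abs, Real.norm_eq_abs, mul_pow, mul_left_comm]
    exact mul_le_mul_of_nonneg_left (hM _ hx.1 hx.2 k) (by positivity)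
  have hint : ∀ k, Integrable (fun x => t ^ k * taylorCoeff k v (x - z)) μ := fun k =>
    Integrable.of_bound ((hmeas k).const_mul _) _ (hbound k)
  have hsum : Summable fun k => ∫ x, ‖t ^ k * taylorCoeff k v (x - z)‖ ∂μ := by
    have hlt : |t| * (4 / ρ) < 1 := by
      rw [mul_div_assoc', div_lt_one hρ]; linarith
    refine Summable.of_nonneg_of_le (fun k => integral_nonneg fun _ => norm_nonneg _)
      (fun k => ?_) (((summable_geometric_of_lt_one (by positivity) hlt).mul_left M).mul_right
        (μ.real univ))
    have := norm_integral_le_of_norm_le_const (μ := μ) (C := M * (|t| * (4 / ρ)) ^ k)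
      (f := fun x => ‖t ^ k * taylorCoeff k v (x - z)‖)
      (by simpa only [norm_norm] using hbound k)
    exact (le_abs_self _).trans this
  have h := hasSum_integral_of_summable_integral_norm hint hsum
  simp only [integral_const_mul] at h
  have heq : ∫ x, fundSol d (‖x - (z + t • v)‖ ^ 2) ∂μ =
      ∫ x, ∑' k, t ^ k * taylorCoeff k v (x - z) ∂μ := by
    refine integral_congr_ae ?_
    filter_upwards [hμ] with x hx
    have := (hasSum_taylorCoeff hv (w := x - z) (t := t) (by linarith [hx.1])).tsum_eq
    rw [this, sub_add_eq_sub_sub]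
  rwa [heq]

lemma eq_of_hasSum_pow {a b : ℕ → ℝ} {f : ℝ → ℝ} {r : ℝ} (hr : 0 < r)
    (ha : ∀ t, |t| < r → HasSum (fun k => t ^ k * a k) (f t))
    (hb : ∀ t, |t| < r → HasSum (fun k => t ^ k * b k) (f t)) : a = b := by
  have key : ∀ c : ℕ → ℝ, (∀ t, |t| < r → HasSum (fun k => t ^ k * c k) (f t)) →
      HasFPowerSeriesAt f (FormalMultilinearSeries.ofScalars ℝ c) 0 := fun c hc => by
    rw [hasFPowerSeriesAt_iff]
    filter_upwards [ball_mem_nhds (0 : ℝ) hr] with t ht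
    simpa [FormalMultilinearSeries.coeff_ofScalars] using hc t (by simpa using ht)
  have h := (key a ha).eq_formalMultilinearSeries (key b hb)
  funext k
  have := congrArg (fun p => FormalMultilinearSeries.coeff p k) h
  simpa [FormalMultilinearSeries.coeff_ofScalars] using this

theorem harmOn_taylorCoeff {d : ℕ} {v : Euc d} (hv : ‖v‖ ≤ 1) (k : ℕ) :
    HarmOn (taylorCoeff k v) {0}ᶜ := by
  refine ⟨continuousOn_taylorCoeff hv k, fun x r hr hsub => ?_⟩
  have hx : r < ‖x‖ := by
    by_contra! h
    exact hsub (mem_closedBall.2 (by simpa using h)) rfl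
  set ρ := ‖x‖ - r
  have hρ : 0 < ρ := sub_pos.2 hx
  rw [eq_setAverage_closedBall_iff hr]
  have hball : ∀ y ∈ closedBall x r, ρ ≤ ‖y‖ ∧ ‖y‖ ≤ ‖x‖ + r := fun y hy => by
    have h1 := norm_sub_norm_le x y
    have h2 := norm_sub_norm_le y x
    have h3 := mem_closedBall.1 hy
    rw [dist_eq_norm] at h3
    rw [norm_sub_rev] at h1
    exact ⟨by simp only [ρ]; linarith, by linarith⟩
  have hμ : ∀ᵐ y ∂(volume.restrict (closedBall x r)), ρ ≤ ‖y - 0‖ ∧ ‖y - 0‖ ≤ ‖x‖ + r := by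
    filter_upwards [ae_restrict_mem measurableSet_closedBall] with y hy
    simpa using hball y hy
  have : IsFiniteMeasure (volume.restrict (closedBall x r)) :=
    isFiniteMeasure_restrict.2 measure_closedBall_lt_top.ne
  have hfun := eq_of_hasSum_pow (a := fun k => ∫ y in closedBall x r, taylorCoeff k v y)
    (b := fun k => volume.real (closedBall x r) * taylorCoeff k v x)
    (f := fun t => ∫ y in closedBall x r, fundSol d (‖y - t • v‖ ^ 2))
    (r := ρ / 4) (by positivity) (fun t ht => by
      simpa using hasSum_integral_taylorCoeff hρ hμ hv ht) (fun t ht => by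
      have h1 := (hasSum_taylorCoeff hv (w := x) (t := t)
        (by have := (hball x (mem_closedBall_self hr.le)).1; linarith)).mul_left
          (volume.real (closedBall x r))
      have h2 : HarmOn (fun y => fundSol d (‖y + -(t • v)‖ ^ 2)) {y : Euc d | y - t • v ≠ 0} :=
        (harmOn_fundSol d).comp_add _ fun y hy => by simpa [sub_eq_add_neg] using hy
      have h3 := (eq_setAverage_closedBall_iff hr).1 (h2.2 x r hr fun y hy => by
        have h4 : ‖t • v‖ ≤ ρ / 4 := by
          rw [norm_smul, Real.norm_eq_abs]
          have := mul_le_mul ht.le hv (norm_nonneg _) (by positivity)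
          simpa using this
        intro h5
        have := (hball y hy).1
        rw [sub_eq_zero.1 h5] at this
        linarith)
      simp only [← sub_eq_add_neg] at h3
      rw [h3]
      refine h1.congr_fun fun k => by ring)
  exact congrFun hfun k

/-- The potential of a measure with respect to the (unnormalized) fundamental solution of the
Laplacian. -/
def potential {d : ℕ} (μ : Measure (Euc d)) (y : Euc d) : ℝ := ∫ x, fundSol d (‖x - y‖ ^ 2) ∂μ

section Potential

variable {d : ℕ} {β δ : Measure (Euc d)} [IsFiniteMeasure β] [IsFiniteMeasure δ]
  {S : Set (Euc d)}

lemma hasSum_potential (hS : IsCompact S) (hβ : ∀ᵐ x ∂β, x ∈ S) {z v : Euc d} {ρ : ℝ} (hρ : 0 < ρ) (hz : ∀ x ∈ S, ρ ≤ ‖x - z‖)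
    (hv : ‖v‖ ≤ 1) {t : ℝ} (ht : |t| < ρ / 4) :
    HasSum (fun k => t ^ k * ∫ x, taylorCoeff k v (x - z) ∂β) (potential β (z + t • v)) := by
  obtain ⟨R, hR⟩ := (hS.image (continuous_id.sub continuous_const : Continuous fun x => x - z)
    ).isBounded.exists_norm_le
  refine hasSum_integral_taylorCoeff (R := R) hρ ?_ hv ht
  filter_upwards [hβ] with x hx
  exact ⟨hz x hx, hR _ ⟨x, hx, rfl⟩⟩

lemma potential_eq_of_taylorCoeff (hS : IsCompact S) (hβ : ∀ᵐ x ∂β, x ∈ S)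
    (hδ : ∀ᵐ x ∂δ, x ∈ S) {z : Euc d} {ρ : ℝ} (hρ : 0 < ρ)
    (hz : ∀ x ∈ S, ρ ≤ ‖x - z‖)
    (h : ∀ k, ∀ v : Euc d, ‖v‖ ≤ 1 →
      ∫ x, taylorCoeff k v (x - z) ∂β = ∫ x, taylorCoeff k v (x - z) ∂δ)
    {y : Euc d} (hy : y ∈ ball z (ρ / 4)) : potential β y = potential δ y := by
  set t := ‖y - z‖
  set v := t⁻¹ • (y - z)
  have hv : ‖v‖ ≤ 1 := by
    simp only [v, norm_smul, norm_inv, t, norm_norm]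
    exact inv_mul_le_one
  have hty : z + t • v = y := by
    rcases eq_or_ne t 0 with h0 | h0
    · rw [h0, zero_smul, add_zero, (sub_eq_zero.1 (norm_eq_zero.1 h0) : y = z)]
    · simp [v, smul_smul, mul_inv_cancel₀ h0]
  have ht : |t| < ρ / 4 := by
    rw [abs_of_nonneg (norm_nonneg _)]
    simpa [dist_eq_norm] using hy
  have h1 := hasSum_potential hS hβ hρ hz hv ht
  have h2 := hasSum_potential hS hδ hρ hz hv ht
  simp only [h _ v hv] at h1
  rw [← hty]
  exact h1.unique h2

lemma potential_eq_on_ball (hS : IsCompact S) (hβ : ∀ᵐ x ∂β, x ∈ S)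
    (hδ : ∀ᵐ x ∂δ, x ∈ S) {z : Euc d} {ρ : ℝ} (hρ : 0 < ρ)
    (hz : ∀ x ∈ S, ρ ≤ ‖x - z‖)
    (h : ∀ᶠ y in 𝓝 z, potential β y = potential δ y)
    {y : Euc d} (hy : y ∈ ball z (ρ / 4)) : potential β y = potential δ y := by
  obtain ⟨ε, hε, hball⟩ := Metric.eventually_nhds_iff_ball.1 h
  refine potential_eq_of_taylorCoeff hS hβ hδ hρ hz (fun k v hv => ?_) hy
  refine congrFun (eq_of_hasSum_pow (b := fun k => ∫ x, taylorCoeff k v (x - z) ∂δ) (f := fun t => potential β (z + t • v))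
    (r := min (ρ / 4) ε) (by positivity)
    (fun t ht => hasSum_potential hS hβ hρ hz hv (ht.trans_le (min_le_left _ _)))
    fun t ht => ?_) k
  have hb : z + t • v ∈ ball z ε := by
    rw [mem_ball, dist_eq_norm, add_sub_cancel_left, norm_smul, Real.norm_eq_abs]
    exact (mul_le_of_le_one_right (abs_nonneg t) hv).trans_lt (ht.trans_le (min_le_right _ _))
  have := hasSum_potential hS hδ hρ hz hv (ht.trans_le (min_le_left _ _))
  simpa only [hball _ hb] using this

/-- If two measures on a compact set `S` integrate all functions harmonic on `O ⊇ S` to the same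
values, then their potentials agree outside a compact subset of the inward filling of `S`. -/
theorem exists_isCompact_potential_eq (hd : 0 < d) (hS : IsCompact S) (hβ : ∀ᵐ x ∂β, x ∈ S)
    (hδ : ∀ᵐ x ∂δ, x ∈ S) {O : Set (Euc d)} (hSO : S ⊆ O)
    (hhar : ∀ h : Euc d → ℝ, HarmOn h O → ∫ x, h x ∂β = ∫ x, h x ∂δ) :
    ∃ K, IsCompact K ∧ S ⊆ K ∧ K ⊆ infill O S ∧ ∀ y ∉ K, potential β y = potential δ y := by
  set A : Set (Euc d) := {y | y ∉ S ∧ ∀ᶠ y' in 𝓝 y, potential β y' = potential δ y'}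
  have hdist : ∀ z ∉ S, ∃ ρ > 0, ∀ x ∈ S, ρ ≤ ‖x - z‖ := fun z hz => by
    obtain ⟨ρ, hρ, hb⟩ := Metric.isOpen_iff.1 hS.isClosed.isOpen_compl z hz
    refine ⟨ρ, hρ, fun x hx => ?_⟩
    by_contra! hlt
    exact hb (by simpa [dist_eq_norm] using hlt) hx
  have hAopen : IsOpen A :=
    hS.isClosed.isOpen_compl.inter isOpen_setOfPred_eventually_nhds
  have hAclosed : ∀ z ∉ S, z ∈ closure A → z ∈ A := fun z hz hzA => by
    obtain ⟨ρ, hρ, hρS⟩ := hdist z hz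
    obtain ⟨w, hwA, hw⟩ := Metric.mem_closure_iff.1 hzA (ρ / 8) (by positivity)
    have hzw : z ∈ ball w (ρ / 2 / 4) := by rw [mem_ball]; linarith
    refine ⟨hz, ?_⟩
    filter_upwards [isOpen_ball.mem_nhds hzw] with y hy
    refine potential_eq_on_ball hS hβ hδ (half_pos hρ) (fun x hx => ?_) hwA.2 hy
    have h1 := hρS x hx
    have h2 := norm_sub_le_norm_sub_add_norm_sub x w z
    rw [← dist_eq_norm w z, dist_comm] at h2
    linarith
  have hOA : ∀ z ∉ O, z ∈ A := fun z hz => by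
    have hzS : z ∉ S := fun h => hz (hSO h)
    obtain ⟨ρ, hρ, hρS⟩ := hdist z hzS
    refine ⟨hzS, ?_⟩
    filter_upwards [ball_mem_nhds z (by positivity : 0 < ρ / 4)] with y hy
    refine potential_eq_of_taylorCoeff hS hβ hδ hρ hρS (fun k v hv => hhar _ ?_) hy
    simp only [sub_eq_add_neg]
    refine (harmOn_taylorCoeff hv k).comp_add (-z) fun x hx h0 => hz ?_
    rw [← sub_eq_add_neg, mem_singleton_iff, sub_eq_zero] at h0
    exact h0 ▸ hx
  obtain ⟨R, hR, hSR⟩ : ∃ R > 0, S ⊆ closedBall 0 R := by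
    obtain ⟨R, hR⟩ := hS.isBounded.subset_closedBall 0
    exact ⟨max R 1, by positivity, hR.trans (closedBall_subset_closedBall (le_max_left _ _))⟩
  have hfar : ∀ y : Euc d, R < ‖y‖ → potential β y = potential δ y := fun y hy => by
    have hne : closedBall (0 : Euc d) R ⊆ {x | x + -y ∈ ({0}ᶜ : Set (Euc d))} := fun x hx h0 => by
      rw [← sub_eq_add_neg, mem_singleton_iff, sub_eq_zero] at h0
      rw [mem_closedBall_zero_iff, h0] at hx
      linarith
    have hharm : HarmOn (fun x => fundSol d (‖x + -y‖ ^ 2)) (closedBall 0 R) :=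
      (harmOn_fundSol d).comp_add (-y) hne
    simp only [← sub_eq_add_neg] at hharm
    have hcont := hharm.1
    have hi : ∀ (μ : Measure (Euc d)) [IsFiniteMeasure μ], (∀ᵐ x ∂μ, x ∈ S) →
        ∀ g : Euc d → ℝ, ContinuousOn g (closedBall 0 R) → Integrable g μ := fun μ _ hμ g hg => by
      have hmem : ∀ᵐ x ∂μ, x ∈ closedBall (0 : Euc d) R := hμ.mono fun x hx => hSR hx
      have := hg.integrableOn_compact (μ := μ) (isCompact_closedBall 0 R)
      rwa [IntegrableOn, Measure.restrict_eq_self_of_ae_mem hmem] at this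
    have happrox : ∀ ε > 0, |potential β y - potential δ y| ≤
        ε * (β.real univ + δ.real univ) := fun ε hε => by
      obtain ⟨q, hq, hqε⟩ := exists_harmonic_polynomial_near hd hR hcont
        (hharm.mono ball_subset_closedBall) hε
      have hqc : Continuous (polyFun q) := (contDiff_polyFun q (n := 0)).continuous
      have hb : ∀ (μ : Measure (Euc d)) [IsFiniteMeasure μ], (∀ᵐ x ∂μ, x ∈ S) →
          |∫ x, polyFun q x ∂μ - potential μ y| ≤ ε * μ.real univ := fun μ _ hμ => by
        rw [potential, ← integral_sub (hi μ hμ _ hqc.continuousOn) (hi μ hμ _ hcont)]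
        have hae : ∀ᵐ x ∂μ, ‖polyFun q x - fundSol d (‖x - y‖ ^ 2)‖ ≤ ε :=
          hμ.mono fun x hx => hqε x (hSR hx)
        exact norm_integral_le_of_norm_le_const hae
      have h1 := abs_le.1 (hb β hβ)
      have h2 := abs_le.1 (hb δ hδ)
      rw [hhar _ ((harmOn_polyFun hq).mono (subset_univ O))] at h1
      rw [abs_le]
      constructor <;> nlinarith [h1, h2]
    have hlim : Tendsto (fun ε : ℝ => ε * (β.real univ + δ.real univ)) (𝓝[>] 0) (𝓝 0) := by
      have : Tendsto (fun ε : ℝ => ε * (β.real univ + δ.real univ)) (𝓝 0)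
          (𝓝 (0 * (β.real univ + δ.real univ))) := by
        exact (continuous_id.mul continuous_const).tendsto _
      rw [zero_mul] at this
      exact this.mono_left nhdsWithin_le_nhds
    have := ge_of_tendsto hlim (eventually_mem_nhdsWithin.mono fun ε hε => happrox ε hε)
    exact sub_eq_zero.1 (abs_nonpos_iff.1 this)
  have hfarA : ∀ y : Euc d, R < ‖y‖ → y ∈ A := fun y hy => by
    refine ⟨fun hyS => ?_, ?_⟩
    · have := mem_closedBall_zero_iff.1 (hSR hyS)
      linarith
    · filter_upwards [(isOpen_lt continuous_const continuous_norm).mem_nhds hy] with w hw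
      exact hfar w hw
  refine ⟨Aᶜ, ?_, fun x hx hxA => hxA.1 hx, fun y hy => ?_, fun y hy => ?_⟩
  · refine (isCompact_closedBall (0 : Euc d) R).of_isClosed_subset hAopen.isClosed_compl
      fun y hy => ?_
    rw [mem_closedBall_zero_iff]
    by_contra! hlt
    exact hy (hfarA y hlt)
  · by_cases hyS : y ∈ S
    · exact Or.inl hyS
    refine Or.inr ?_
    set C := connectedComponentIn Sᶜ y with hC
    have hyC : y ∈ C := mem_connectedComponentIn hyS
    have hCpre : IsPreconnected C := isPreconnected_connectedComponentIn
    have hCS : C ⊆ Sᶜ := connectedComponentIn_subset _ _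
    have hCA : ∀ z ∈ C, z ∉ A := fun z hzC hzA => by
      obtain ⟨w, -, hw⟩ := hCpre A (closure A)ᶜ hAopen isClosed_closure.isOpen_compl
        (fun w hw => or_iff_not_imp_right.2 fun h => hAclosed w (hCS hw) (not_not.1 h))
        ⟨z, hzC, hzA⟩ ⟨y, hyC, fun h => hy (hAclosed y hyS h)⟩
      exact hw.2 (subset_closure hw.1)
    have hCO : C ⊆ O := fun z hz => by
      by_contra h
      exact hCA z hz (hOA z h)
    have hyO : y ∈ O \ S := ⟨hCO hyC, hyS⟩
    have heq : connectedComponentIn (O \ S) y = C :=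
      (connectedComponentIn_mono y fun z hz => hz.2).antisymm
        (hCpre.subset_connectedComponentIn hyC fun z hz => ⟨hCO hz, hCS hz⟩)
    refine ⟨y, hyO, ?_, ?_, ?_⟩
    · rwa [heq]
    · rw [heq]
      refine (isCompact_closedBall (0 : Euc d) R).of_isClosed_subset isClosed_closure
        (closure_minimal (fun z hz => ?_) isClosed_closedBall)
      rw [mem_closedBall_zero_iff]
      by_contra! hlt
      exact hCA z hz (hfarA z hlt)
    · rw [heq]
      intro z hz
      by_cases hzS : z ∈ S
      · exact hSO hzS
      have hpre : IsPreconnected (insert z C) :=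
        hCpre.subset_closure (subset_insert _ _) (insert_subset hz subset_closure)
      exact hCO (hpre.subset_connectedComponentIn (mem_insert_of_mem z hyC)
        (insert_subset hzS hCS) (mem_insert z C))
  · exact (not_not.1 hy).2.self_of_nhds

end Potential

/-- The integral of `f` over the closed ball of radius `r` centred at `x`. -/
def ballIntegral {d : ℕ} (r : ℝ) (f : Euc d → ℝ) (x : Euc d) : ℝ :=
  ∫ z in closedBall 0 r, f (x + z)

lemma ballIntegral_eq {d : ℕ} (r : ℝ) (f : Euc d → ℝ) (x : Euc d) :
    ballIntegral r f x = ∫ y in closedBall x r, f y := by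
  simp only [ballIntegral, add_comm x, setIntegral_closedBall_comp_add, zero_add]

lemma continuous_ballIntegral {d : ℕ} (r : ℝ) {f : Euc d → ℝ} (hf : Continuous f) :
    Continuous (ballIntegral r f) :=
  continuous_parametric_integral_of_continuous (f := fun x z => f (x + z)) (by fun_prop)
    (isCompact_closedBall 0 r)

lemma integral_integral_swap_of_isCompact {X : Type*} [TopologicalSpace X] [MeasurableSpace X]
    [BorelSpace X] [SecondCountableTopology X] [T2Space X] {μ ν : Measure X} [IsFiniteMeasure μ]
    [SFinite ν] [IsFiniteMeasureOnCompacts ν] {T K : Set X} (hT : IsCompact T) (hK : IsCompact K)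
    (hμ : ∀ᵐ x ∂μ, x ∈ T) {F : X → X → ℝ} (hF : Continuous (Function.uncurry F))
    (h0 : ∀ x ∈ T, ∀ y ∉ K, F x y = 0) :
    ∫ x, ∫ y, F x y ∂ν ∂μ = ∫ y, ∫ x, F x y ∂μ ∂ν := by
  have : IsFiniteMeasure (ν.restrict K) := isFiniteMeasure_restrict.2 hK.measure_lt_top.ne
  refine integral_integral_swap ?_
  have hint : IntegrableOn (Function.uncurry F) (T ×ˢ K) (μ.prod ν) := by
    obtain ⟨M, hM⟩ := (hT.prod hK).exists_bound_of_continuousOn hF.continuousOn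
    rw [IntegrableOn, ← Measure.prod_restrict]
    refine Integrable.of_bound hF.aestronglyMeasurable M ?_
    rw [Measure.prod_restrict]
    filter_upwards [ae_restrict_mem (hT.measurableSet.prod hK.measurableSet)] with p hp
    exact hM p hp
  refine hint.integrable_of_ae_notMem_eq_zero ?_
  filter_upwards [Measure.quasiMeasurePreserving_fst.ae hμ] with p hp hpT
  exact h0 p.1 hp p.2 fun hpK => hpT ⟨hp, hpK⟩

lemma integral_mul_radial_of_nonneg {d : ℕ} (hd : 0 < d) {F : Euc d → ℝ} {ρ c : ℝ}
    (hF : ContinuousOn F (closedBall 0 ρ)) (hF0 : ∀ y ∈ closedBall 0 ρ, 0 ≤ F y) (hc : 0 ≤ c)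
    (hm : ∀ s, 0 < s → s ≤ ρ →
      ∫ y in closedBall 0 s, F y = volume.real (closedBall (0 : Euc d) s) * c)
    {p : ℝ → ℝ} (hp : Continuous p) :
    ∫ y in closedBall 0 ρ, F y * p ‖y‖ = c * ∫ y in closedBall (0 : Euc d) ρ, p ‖y‖ := by
  have : Nonempty (Fin d) := ⟨⟨0, hd⟩⟩
  set B : Set (Euc d) := closedBall 0 ρ
  set m : Measure (Euc d) := volume.restrict B
  have hfin : IsFiniteMeasure m := isFiniteMeasure_restrict.2 measure_closedBall_lt_top.ne
  have key : ∀ G : Euc d → ℝ, ContinuousOn G B → (∀ y ∈ B, 0 ≤ G y) →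
      ∫ y in B, G y * p ‖y‖ =
        ∫ s, p s ∂((m.withDensity fun y => ENNReal.ofReal (G y)).map fun y => ‖y‖) := by
    intro G hG hG0
    rw [integral_map (by fun_prop) hp.aestronglyMeasurable,
      integral_withDensity_eq_integral_toReal_smul₀]
    · refine setIntegral_congr_fun measurableSet_closedBall fun y hy => ?_
      simp [ENNReal.toReal_ofReal (hG0 y hy)]
    · exact (hG.aemeasurable measurableSet_closedBall).ennreal_ofReal
    · simp
  have hIic : ∀ G : Euc d → ℝ, ContinuousOn G B → (∀ y ∈ B, 0 ≤ G y) → ∀ a,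
      ((m.withDensity fun y => ENNReal.ofReal (G y)).map fun y => ‖y‖) (Iic a) =
        ENNReal.ofReal (∫ y in closedBall 0 (min a ρ), G y) := by
    intro G hG hG0 a
    have hset : (fun y : Euc d => ‖y‖) ⁻¹' Iic a = closedBall 0 a := by
      ext y; simp
    rw [Measure.map_apply (by fun_prop) measurableSet_Iic, hset,
      withDensity_apply _ measurableSet_closedBall, Measure.restrict_restrict
      measurableSet_closedBall]
    have hinter : closedBall (0 : Euc d) a ∩ B = closedBall 0 (min a ρ) := by
      ext y; simp [B]
    rw [hinter, ofReal_integral_eq_lintegral_ofReal]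
    · exact (hG.mono (closedBall_subset_closedBall (min_le_right _ _))).integrableOn_compact
        (isCompact_closedBall _ _)
    · filter_upwards [ae_restrict_mem measurableSet_closedBall] with y hy
      exact hG0 y (closedBall_subset_closedBall (min_le_right _ _) hy)
  have hcint : ∫ y in B, c * p ‖y‖ = c * ∫ y in B, p ‖y‖ := integral_const_mul _ _
  rw [← hcint, key F hF hF0, key (fun _ => c) continuousOn_const fun _ _ => hc]
  congr 1
  have hfin' : IsFiniteMeasure (m.withDensity fun y => ENNReal.ofReal (F y)) := by
    refine isFiniteMeasure_withDensity_ofReal ?_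
    exact (hF.integrableOn_compact (isCompact_closedBall 0 ρ)).2
  refine Measure.ext_of_Iic _ _ fun a => ?_
  rw [hIic F hF hF0, hIic (fun _ => c) continuousOn_const fun _ _ => hc]
  rcases lt_or_ge 0 (min a ρ) with h | h
  · rw [hm _ h (min_le_right _ _)]; simp
  · have hnull : volume (closedBall (0 : Euc d) (min a ρ)) = 0 := by
      refine measure_mono_null (closedBall_subset_closedBall h) ?_
      simp
    rw [Measure.restrict_eq_zero.2 hnull]; simp

/-- Integration of a harmonic function against a radial weight. -/
lemma HarmOn.integral_mul_radial {d : ℕ} (hd : 0 < d) {h : Euc d → ℝ} {x : Euc d} {ρ : ℝ}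
    (hh : HarmOn h (closedBall x ρ)) {p : ℝ → ℝ} (hp : Continuous p) :
    ∫ y in closedBall 0 ρ, h (x + y) * p ‖y‖ =
      h x * ∫ y in closedBall (0 : Euc d) ρ, p ‖y‖ := by
  rcases lt_or_ge ρ 0 with hρ | hρ
  · simp [closedBall_eq_empty.2 hρ]
  have hcont : ContinuousOn (fun y => h (x + y)) (closedBall 0 ρ) :=
    hh.1.comp (by fun_prop) fun y hy => by simpa using hy
  obtain ⟨C, hC⟩ := (isCompact_closedBall (0 : Euc d) ρ).exists_bound_of_continuousOn hcont
  have hCx : |h x| ≤ C := by simpa using hC 0 (mem_closedBall_self hρ)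
  have hpc : Continuous fun y : Euc d => p ‖y‖ := by fun_prop
  have hi : ∀ {f : Euc d → ℝ}, ContinuousOn f (closedBall 0 ρ) →
      IntegrableOn f (closedBall 0 ρ) := fun hf => hf.integrableOn_compact (isCompact_closedBall _ _)
  have h1 := integral_mul_radial_of_nonneg hd (F := fun y => h (x + y) + C) (ρ := ρ) (c := h x + C)
    (hcont.add continuousOn_const) (fun y hy => by linarith [(abs_le.1 (hC y hy)).1])
    (by linarith [(abs_le.1 hCx).1]) (fun s hs hsρ => by
      have hsub := closedBall_subset_closedBall (x := x) hsρ
      rw [integral_add ((hi hcont).mono_set (closedBall_subset_closedBall hsρ))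
        (integrableOn_const measure_closedBall_lt_top.ne)]
      have := (eq_setAverage_closedBall_iff hs).1 (hh.2 x s hs hsub)
      rw [← ballIntegral_eq, ballIntegral] at this
      have hv : volume.real (closedBall x s) = volume.real (closedBall (0 : Euc d) s) := by
        rw [Measure.real, Measure.real, Measure.addHaar_closedBall_center]
      rw [this, setIntegral_const, smul_eq_mul, mul_add, hv]) hp
  have hi1 : IntegrableOn (fun y => h (x + y) * p ‖y‖) (closedBall 0 ρ) :=
    hi (hcont.mul hpc.continuousOn)
  have hi2 : IntegrableOn (fun y : Euc d => C * p ‖y‖) (closedBall 0 ρ) := hi (by fun_prop)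
  simp only [add_mul] at h1
  rw [integral_add hi1 hi2, integral_const_mul] at h1
  linarith

/-- The defect in the mean value property of the smoothed fundamental solution. -/
def meanDefect (d : ℕ) (r : ℝ) (x : Euc d) : ℝ :=
  volume.real (closedBall (0 : Euc d) r) * truncSol d (r ^ 2 / 4) x -
    ballIntegral r (truncSol d (r ^ 2 / 4)) x

lemma volume_real_closedBall_center {d : ℕ} (x : Euc d) (r : ℝ) :
    volume.real (closedBall x r) = volume.real (closedBall (0 : Euc d) r) := by
  rw [Measure.real, Measure.real, Measure.addHaar_closedBall_center]

lemma continuous_truncSol (d : ℕ) {e : ℝ} (he : 0 < e) : Continuous (truncSol d e) :=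
  (contDiff_truncSol d he).continuous

lemma continuous_meanDefect (d : ℕ) {r : ℝ} (hr : 0 < r) : Continuous (meanDefect d r) := by
  have := continuous_truncSol d (e := r ^ 2 / 4) (by positivity)
  exact (continuous_const.mul this).sub (continuous_ballIntegral r this)

lemma meanDefect_eq_of_norm_eq {d : ℕ} (r : ℝ) {x y : Euc d} (hxy : ‖x‖ = ‖y‖) :
    meanDefect d r x = meanDefect d r y := by
  set L := (ℝ ∙ (x - y))ᗮ.reflection
  have hL : L x = y := Submodule.reflection_sub hxy
  have hE : truncSol d (r ^ 2 / 4) x = truncSol d (r ^ 2 / 4) y := by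
    rw [truncSol, truncSol, hxy]
  rw [meanDefect, meanDefect, hE]
  congr 1
  rw [ballIntegral, ballIntegral, ← hL,
    ← L.measurePreserving.setIntegral_preimage_emb L.toHomeomorph.measurableEmbedding]
  have hpre : L ⁻¹' closedBall 0 r = closedBall 0 r := by
    ext z; simp
  rw [hpre]
  refine setIntegral_congr_fun measurableSet_closedBall fun z _ => ?_
  have hn : ‖x + L z‖ = ‖L x + z‖ := by
    rw [← L.norm_map, map_add, Submodule.reflection_reflection]
  rw [truncSol, truncSol, hn]

lemma meanDefect_nonpos {d : ℕ} {r : ℝ} (hr : 0 < r) (x : Euc d) : meanDefect d r x ≤ 0 := by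
  have he : 0 < r ^ 2 / 4 := by positivity
  have := le_setAverage_of_coordLaplacian_nonneg (contDiff_truncSol d he) (x := x) hr
    fun y _ => coordLaplacian_truncSol_nonneg he y
  rw [le_setAverage_closedBall_iff hr, volume_real_closedBall_center, ← ballIntegral_eq] at this
  exact sub_nonpos.2 this

lemma meanDefect_eq_zero {d : ℕ} {r : ℝ} (hr : 0 < r) {x : Euc d} (hx : 2 * r ≤ ‖x‖) :
    meanDefect d r x = 0 := by
  have he : 0 < r ^ 2 / 4 := by positivity
  have := eq_setAverage_of_coordLaplacian_eq_zero (contDiff_truncSol d he) (x := x) hr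
    fun y hy => coordLaplacian_truncSol_eq_zero he (by
      have h1 := norm_sub_norm_le x y
      rw [← dist_eq_norm, dist_comm] at h1
      have h2 := mem_closedBall.1 hy
      nlinarith)
  rw [eq_setAverage_closedBall_iff hr, volume_real_closedBall_center, ← ballIntegral_eq] at this
  rw [meanDefect, this, sub_self]

lemma meanDefect_zero_neg {d : ℕ} (hd : 0 < d) {r : ℝ} (hr : 0 < r) :
    meanDefect d r 0 < 0 := by
  have he : 0 < r ^ 2 / 4 := by positivity
  have hpos : 0 < ∫ z in closedBall 0 r, truncSol d (r ^ 2 / 4) z := by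
    rw [setIntegral_pos_iff_support_of_nonneg_ae
      (Eventually.of_forall fun z => truncSol_nonneg he z)
      ((continuous_truncSol d he).continuousOn.integrableOn_compact (isCompact_closedBall 0 r))]
    have hn : ‖EuclideanSpace.single (⟨0, hd⟩ : Fin d) (3 * r / 4)‖ = 3 * r / 4 := by
      rw [PiLp.norm_single, Real.norm_of_nonneg (by positivity)]
    refine (measure_ball_pos volume (EuclideanSpace.single (⟨0, hd⟩ : Fin d) (3 * r / 4))
      (by positivity : 0 < r / 4)).trans_le (measure_mono fun z hz => ?_)
    rw [mem_ball, dist_eq_norm] at hz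
    have h1 := norm_sub_norm_le (EuclideanSpace.single (⟨0, hd⟩ : Fin d) (3 * r / 4)) z
    have h2 := norm_sub_norm_le z (EuclideanSpace.single (⟨0, hd⟩ : Fin d) (3 * r / 4))
    rw [norm_sub_rev] at h1
    rw [hn] at h1 h2
    refine ⟨(truncSol_pos he ?_).ne', mem_closedBall_zero_iff.2 (by linarith)⟩
    nlinarith
  simpa [meanDefect, truncSol_zero, ballIntegral] using hpos

lemma integral_meanDefect_neg {d : ℕ} (hd : 0 < d) {r : ℝ} (hr : 0 < r) :
    ∫ x, meanDefect d r x < 0 := by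
  have hs : HasCompactSupport fun x => -meanDefect d r x :=
    HasCompactSupport.intro (isCompact_closedBall (0 : Euc d) (2 * r)) fun x hx => by
      rw [mem_closedBall_zero_iff, not_le] at hx
      rw [meanDefect_eq_zero hr hx.le, neg_zero]
  have := (continuous_meanDefect d hr).neg.integral_pos_of_hasCompactSupport_nonneg_nonzero
    (μ := volume) (x := 0) hs (fun x => neg_nonneg.2 (meanDefect_nonpos hr x))
    (neg_ne_zero.2 (meanDefect_zero_neg hd hr).ne)
  simp only [Pi.neg_apply, integral_neg] at this
  linarith

lemma integral_meanDefect_mul {d : ℕ} (hd : 0 < d) {r : ℝ} (hr : 0 < r) {g h : Euc d → ℝ}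
    {x : Euc d} (hh : HarmOn h (closedBall x (2 * r))) (hgh : EqOn g h (closedBall x (2 * r))) :
    ∫ y, g y * meanDefect d r (x - y) = h x * ∫ y, meanDefect d r y := by
  set p : ℝ → ℝ := fun s => meanDefect d r (s • EuclideanSpace.single ⟨0, hd⟩ (1 : ℝ))
  have hp : Continuous p := (continuous_meanDefect d hr).comp (by fun_prop)
  have hpψ : ∀ y, meanDefect d r y = p ‖y‖ := fun y => meanDefect_eq_of_norm_eq r (by
    rw [norm_smul, norm_norm, PiLp.norm_single, norm_one, mul_one])
  have hzero : ∀ y ∉ closedBall (0 : Euc d) (2 * r), meanDefect d r y = 0 := fun y hy =>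
    meanDefect_eq_zero hr (by rw [mem_closedBall_zero_iff, not_le] at hy; exact hy.le)
  have h1 : ∫ y, g y * meanDefect d r (x - y) = ∫ y, g (x + y) * meanDefect d r y := by
    rw [← integral_sub_right_eq_self (fun y => g (x + y) * meanDefect d r y) x]
    refine integral_congr_ae (Eventually.of_forall fun y => ?_)
    simp only [add_sub_cancel]
    rw [meanDefect_eq_of_norm_eq r (norm_sub_rev x y)]
  rw [h1, ← setIntegral_eq_integral_of_forall_compl_eq_zero (s := closedBall 0 (2 * r))
      fun y hy => by rw [hzero y hy, mul_zero],
    ← setIntegral_eq_integral_of_forall_compl_eq_zero (f := meanDefect d r)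
      (s := closedBall 0 (2 * r)) hzero]
  simp only [hpψ]
  rw [← hh.integral_mul_radial hd hp]
  refine setIntegral_congr_fun measurableSet_closedBall fun y hy => ?_
  simp only [hgh (show x + y ∈ closedBall x (2 * r) by simpa using hy)]

lemma ballIntegral_eq_zero {d : ℕ} {r : ℝ} {g : Euc d → ℝ} {K : Set (Euc d)}
    (h0 : ∀ y ∉ K, g y = 0) {y : Euc d}
    (hy : y ∉ (fun p : Euc d × Euc d => p.1 - p.2) '' K ×ˢ closedBall 0 r) :
    ballIntegral r g y = 0 := by
  rw [ballIntegral, setIntegral_congr_fun (g := fun _ => (0 : ℝ)) measurableSet_closedBall,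
    integral_zero]
  intro z hz
  exact h0 _ fun hmem => hy ⟨(y + z, z), ⟨hmem, hz⟩, add_sub_cancel_right y z⟩

lemma isCompact_image_sub_closedBall {d : ℕ} {K : Set (Euc d)} (hK : IsCompact K) (r : ℝ) :
    IsCompact ((fun p : Euc d × Euc d => p.1 - p.2) '' K ×ˢ closedBall 0 r) :=
  (hK.prod (isCompact_closedBall 0 r)).image (by fun_prop)

lemma integral_ballIntegral_mul {d : ℕ} {r : ℝ} {g E : Euc d → ℝ} {K : Set (Euc d)}
    (hg : Continuous g) (hE : Continuous E) (hK : IsCompact K) (h0 : ∀ y ∉ K, g y = 0)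
    (x : Euc d) :
    ∫ y, ballIntegral r g y * E (x - y) = ∫ y, g y * ballIntegral r E (x - y) := by
  set m : Measure (Euc d) := volume.restrict (closedBall 0 r)
  have hfin : IsFiniteMeasure m := isFiniteMeasure_restrict.2 measure_closedBall_lt_top.ne
  have hm : ∀ᵐ z ∂m, z ∈ closedBall (0 : Euc d) r := ae_restrict_mem measurableSet_closedBall
  calc ∫ y, ballIntegral r g y * E (x - y)
      = ∫ y, (∫ z, g (y + z) * E (x - y) ∂m) := by
        simp only [integral_mul_const, ballIntegral, m]
    _ = ∫ z, (∫ y, g (y + z) * E (x - y)) ∂m := by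
        refine (integral_integral_swap_of_isCompact (isCompact_closedBall 0 r)
          (isCompact_image_sub_closedBall hK r) hm
          (F := fun z y => g (y + z) * E (x - y)) (by fun_prop) fun z hz y hy => ?_).symm
        rw [h0 _ fun hmem => hy ⟨(y + z, z), ⟨hmem, hz⟩, add_sub_cancel_right y z⟩, zero_mul]
    _ = ∫ z, (∫ y, g y * E (x - y + z)) ∂m := by
        refine integral_congr_ae (Eventually.of_forall fun z => ?_)
        simp only
        rw [← integral_add_right_eq_self (fun y => g y * E (x - y + z)) z]
        refine integral_congr_ae (Eventually.of_forall fun y => ?_)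
        simp only
        congr 2
        abel
    _ = ∫ y, (∫ z, g y * E (x - y + z) ∂m) :=
        integral_integral_swap_of_isCompact (isCompact_closedBall 0 r) hK hm
          (F := fun z y => g y * E (x - y + z)) (by fun_prop)
          fun z _ y hy => by rw [h0 y hy, zero_mul]
    _ = ∫ y, g y * ballIntegral r E (x - y) := by
        simp only [integral_const_mul, ballIntegral, m]

lemma integral_sub_ballIntegral_mul {d : ℕ} {r : ℝ} (hr : 0 < r) {g : Euc d → ℝ}
    {K : Set (Euc d)} (hg : Continuous g) (hK : IsCompact K) (h0 : ∀ y ∉ K, g y = 0)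
    (x : Euc d) :
    ∫ y, (volume.real (closedBall (0 : Euc d) r) * g y - ballIntegral r g y) *
      truncSol d (r ^ 2 / 4) (x - y) = ∫ y, g y * meanDefect d r (x - y) := by
  have hE := continuous_truncSol d (e := r ^ 2 / 4) (by positivity)
  set E := truncSol d (r ^ 2 / 4)
  set V := volume.real (closedBall (0 : Euc d) r)
  have hbg := continuous_ballIntegral r hg
  have hbE := continuous_ballIntegral r hE
  have hi1 : Integrable fun y => g y * (V * E (x - y)) :=
    Continuous.integrable_of_hasCompactSupport (by fun_prop)
      (HasCompactSupport.intro hK fun y hy => by rw [h0 y hy, zero_mul])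
  have hi2 : Integrable fun y => g y * ballIntegral r E (x - y) :=
    Continuous.integrable_of_hasCompactSupport (by fun_prop)
      (HasCompactSupport.intro hK fun y hy => by rw [h0 y hy, zero_mul])
  have hi3 : Integrable fun y => ballIntegral r g y * E (x - y) :=
    Continuous.integrable_of_hasCompactSupport (by fun_prop)
      (HasCompactSupport.intro (isCompact_image_sub_closedBall hK r) fun y hy => by
        rw [ballIntegral_eq_zero h0 hy, zero_mul])
  calc ∫ y, (V * g y - ballIntegral r g y) * E (x - y)
      = ∫ y, (g y * (V * E (x - y)) - ballIntegral r g y * E (x - y)) := by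
        congr 1; ext y; ring
    _ = ∫ y, (g y * (V * E (x - y)) - g y * ballIntegral r E (x - y)) := by
        rw [integral_sub hi1 hi3, integral_sub hi1 hi2, integral_ballIntegral_mul hg hE hK h0]
    _ = ∫ y, g y * meanDefect d r (x - y) := by
        congr 1; ext y; rw [meanDefect]; ring

/-- Multiplication of a continuous function near a compact set by a cut-off function. -/
lemma exists_continuous_eqOn_cutoff {d : ℕ} {h : Euc d → ℝ} {K D : Set (Euc d)} {r : ℝ}
    (hr : 0 < r) (hD : IsOpen D) (hKD : {y | infDist y K ≤ 5 * r} ⊆ D) (hh : ContinuousOn h D) :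
    ∃ g : Euc d → ℝ, Continuous g ∧ (∀ y, infDist y K ≤ 3 * r → g y = h y) ∧
      ∀ y, 4 * r ≤ infDist y K → g y = 0 := by
  have hχ0 : ∀ y, 4 * r ≤ infDist y K → max 0 (min 1 (4 - infDist y K / r)) = 0 := by
    intro y hy
    have : 4 ≤ infDist y K / r := by rwa [le_div_iff₀ hr]
    exact max_eq_left (min_le_of_right_le (by linarith))
  refine ⟨fun y => max 0 (min 1 (4 - infDist y K / r)) * h y, ?_, fun y hy => ?_, fun y hy => ?_⟩
  · have hc : Continuous fun y => max 0 (min 1 (4 - infDist y K / r)) := by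
      have := continuous_infDist_pt K
      fun_prop
    refine continuous_iff_continuousAt.2 fun y => ?_
    rcases lt_or_ge (infDist y K) (5 * r) with hy | hy
    · exact hc.continuousAt.mul (hh.continuousAt (hD.mem_nhds (hKD hy.le)))
    · have hev : ∀ᶠ z in 𝓝 y, 4 * r < infDist z K :=
        (continuous_infDist_pt K).continuousAt.eventually_const_lt (by linarith)
      refine (continuousAt_const (y := (0 : ℝ))).congr ?_
      filter_upwards [hev] with z hz
      rw [hχ0 z hz.le, zero_mul]
  · have : infDist y K / r ≤ 3 := by rwa [div_le_iff₀ hr]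
    simp only
    rw [min_eq_left (by linarith), max_eq_right zero_le_one, one_mul]
  · simp only
    rw [hχ0 y hy, zero_mul]

lemma integral_truncSol_sub {d : ℕ} {e : ℝ} (he : 0 < e) :
    ∃ c : ℝ, ∀ (μ : Measure (Euc d)) [IsFiniteMeasure μ] (y : Euc d),
      Integrable (fun x => truncSol d e (x - y)) μ → (∀ᵐ x ∂μ, e ≤ ‖x - y‖ ^ 2) →
        ∫ x, truncSol d e (x - y) ∂μ = potential μ y + c * μ.real univ := by
  obtain ⟨c, hc⟩ := truncSol_eq_fundSol_add (d := d) he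
  refine ⟨c, fun μ _ y hi hμ => ?_⟩
  have hp : potential μ y = ∫ x, (truncSol d e (x - y) - c) ∂μ := by
    refine integral_congr_ae ?_
    filter_upwards [hμ] with x hx
    rw [hc _ hx, add_sub_cancel_right]
  rw [hp, integral_sub hi (integrable_const c), integral_const, smul_eq_mul]
  ring

theorem integral_eq_of_potential_eq {d : ℕ} (hd : 0 < d) {β δ : Measure (Euc d)}
    [IsFiniteMeasure β] [IsFiniteMeasure δ] {K D : Set (Euc d)} (hK : IsCompact K)
    (hKne : K.Nonempty) (hD : IsOpen D) (hKD : K ⊆ D) (hβ : ∀ᵐ x ∂β, x ∈ K)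
    (hδ : ∀ᵐ x ∂δ, x ∈ K) (hmass : β.real univ = δ.real univ)
    (hpot : ∀ y ∉ K, potential β y = potential δ y) {h : Euc d → ℝ} (hh : HarmOn h D) :
    ∫ x, h x ∂β = ∫ x, h x ∂δ := by
  obtain ⟨r, hr, hrD⟩ : ∃ r : ℝ, 0 < r ∧ cthickening (5 * r) K ⊆ D := by
    obtain ⟨ε, hε, h⟩ := hK.exists_cthickening_subset_open hD hKD
    exact ⟨ε / 5, by positivity, by rwa [mul_div_cancel₀ _ (by norm_num)]⟩
  have hcth : cthickening (5 * r) K = {y | infDist y K ≤ 5 * r} := by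
    ext y
    refine ⟨fun hy => ?_, fun hy => ?_⟩
    · exact ENNReal.toReal_le_of_le_ofReal (by positivity) (mem_cthickening_iff.1 hy)
    · exact mem_cthickening_iff.2
        ((ENNReal.le_ofReal_iff_toReal_le (infEDist_ne_top hKne) (by positivity)).2 hy)
  have hK2 : IsCompact {y | infDist y K ≤ 5 * r} := hcth ▸ hK.cthickening
  rw [hcth] at hrD
  have hlip : ∀ {x y : Euc d} {s : ℝ}, y ∈ closedBall x s → infDist y K ≤ infDist x K + s :=
    fun hy => infDist_le_infDist_add_dist.trans (by gcongr; exact hy)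
  obtain ⟨g, hg, hgh, hg0⟩ := exists_continuous_eqOn_cutoff hr hD hrD hh.1
  have he : 0 < r ^ 2 / 4 := by positivity
  have hE := continuous_truncSol d he
  set E := truncSol d (r ^ 2 / 4)
  set V := volume.real (closedBall (0 : Euc d) r)
  set q : Euc d → ℝ := fun y => V * g y - ballIntegral r g y
  have hbg := continuous_ballIntegral r hg
  have hq : Continuous q := (continuous_const.mul hg).sub hbg
  have hq_near : ∀ y, infDist y K ≤ 2 * r → q y = 0 := by
    intro y hy
    have hsub : closedBall y r ⊆ D := fun z hz => hrD (by
      have := hlip hz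
      rw [mem_ofPred_eq]
      linarith)
    have h1 := hh.2 y r hr hsub
    rw [eq_setAverage_closedBall_iff hr, volume_real_closedBall_center] at h1
    have h2 : ballIntegral r g y = V * h y := by
      rw [ballIntegral_eq, ← h1]
      refine setIntegral_congr_fun measurableSet_closedBall fun z hz => hgh z ?_
      have := hlip hz
      linarith
    simp only [q]
    rw [h2, hgh y (by linarith), sub_self]
  have hq_far : ∀ y ∉ {y | infDist y K ≤ 5 * r}, q y = 0 := by
    intro y hy
    rw [mem_ofPred_eq, not_le] at hy
    have h2 : ballIntegral r g y = 0 := by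
      rw [ballIntegral_eq, setIntegral_congr_fun (g := fun _ => (0 : ℝ)) measurableSet_closedBall,
        integral_zero]
      intro z hz
      have := hlip (mem_closedBall_comm.1 hz)
      exact hg0 z (by linarith)
    simp only [q]
    rw [h2, hg0 y (by linarith), mul_zero, sub_zero]
  have hκ := integral_meanDefect_neg hd hr
  set κ := ∫ x, meanDefect d r x
  have hrep : ∀ x ∈ K, h x * κ = ∫ y, q y * E (x - y) := by
    intro x hx
    have hsub : ∀ y ∈ closedBall x (2 * r), infDist y K ≤ 2 * r := fun y hy => by
      have := hlip hy
      rwa [infDist_zero_of_mem hx, zero_add] at this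
    rw [integral_sub_ballIntegral_mul hr hg hK2 fun y hy => hg0 y (by
        rw [mem_ofPred_eq, not_le] at hy; linarith),
      integral_meanDefect_mul hd hr (hh.mono fun y hy => hrD (by
        have := hsub y hy
        rw [mem_ofPred_eq]
        linarith)) fun y hy => hgh y (by have := hsub y hy; linarith)]
  have hswap : ∀ μ : Measure (Euc d), IsFiniteMeasure μ → (∀ᵐ x ∂μ, x ∈ K) →
      (∫ x, h x ∂μ) * κ = ∫ y, q y * (∫ x, E (x - y) ∂μ) := by
    intro μ _ hμ
    rw [← integral_mul_const]
    calc ∫ x, h x * κ ∂μ = ∫ x, (∫ y, q y * E (x - y)) ∂μ := by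
          refine integral_congr_ae ?_
          filter_upwards [hμ] with x hx using hrep x hx
      _ = ∫ y, (∫ x, q y * E (x - y) ∂μ) :=
          integral_integral_swap_of_isCompact hK hK2 hμ (F := fun x y => q y * E (x - y))
            (by fun_prop) fun x _ y hy => by rw [hq_far y hy, zero_mul]
      _ = ∫ y, q y * (∫ x, E (x - y) ∂μ) := by simp only [integral_const_mul]
  obtain ⟨c, hc⟩ := integral_truncSol_sub (d := d) he
  have hEint : ∀ μ : Measure (Euc d), IsFiniteMeasure μ → (∀ᵐ x ∂μ, x ∈ K) → ∀ y,
      2 * r ≤ infDist y K → ∫ x, E (x - y) ∂μ = potential μ y + c * μ.real univ := by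
    intro μ _ hμ y hy
    obtain ⟨M, hM⟩ := hK.exists_bound_of_continuousOn (f := fun x => E (x - y))
      (by fun_prop)
    refine hc μ y (Integrable.of_bound (f := fun x => E (x - y))
      (hE.comp (by fun_prop)).aestronglyMeasurable M (hμ.mono hM)) ?_
    filter_upwards [hμ] with x hx
    have := infDist_le_dist_of_mem (x := y) hx
    rw [dist_comm, dist_eq_norm] at this
    nlinarith
  refine mul_right_cancel₀ hκ.ne ?_
  rw [hswap β ‹_› hβ, hswap δ ‹_› hδ]
  refine integral_congr_ae (Eventually.of_forall fun y => ?_)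
  simp only
  rcases le_or_gt (infDist y K) (2 * r) with hy | hy
  · rw [hq_near y hy, zero_mul, zero_mul]
  · have hyK : y ∉ K := fun hyK => by
      rw [infDist_zero_of_mem hyK] at hy
      linarith
    rw [hEint β ‹_› hβ y hy.le, hEint δ ‹_› hδ y hy.le, hpot y hyK, hmass]

lemma MeasCompIn.ae_mem_msupp {d : ℕ} {μ : Measure (Euc d)} {O : Set (Euc d)}
    (h : MeasCompIn μ O) : ∀ᵐ x ∂μ, x ∈ msupp μ :=
  h.2.2.1

lemma MeasCompIn.isFiniteMeasure {d : ℕ} {μ : Measure (Euc d)} {O : Set (Euc d)}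
    (h : MeasCompIn μ O) : IsFiniteMeasure μ :=
  ⟨h.2.2.2⟩

lemma SubharmOn.integrable {d : ℕ} {v : Euc d → ℝ} {O : Set (Euc d)} (hv : SubharmOn v O)
    (hvm : Measurable v) {L : ℝ} (hL : ∀ x, L ≤ v x) {μ : Measure (Euc d)}
    (hμ : MeasCompIn μ O) : Integrable v μ := by
  have := hμ.isFiniteMeasure
  obtain ⟨M, hM⟩ := (hv.usc.mono hμ.2.1).bddAbove_of_isCompact hμ.1
  refine Integrable.of_mem_Icc L M hvm.aemeasurable ?_
  filter_upwards [hμ.ae_mem_msupp] with x hx using ⟨hL x, hM (mem_image_of_mem v hx)⟩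

lemma integral_eq_of_infill_subset {d : ℕ} (hd : 0 < d) {O : Set (Euc d)}
    {β δ : Measure (Euc d)} (hβ : MeasCompIn β O) (hδ : MeasCompIn δ O)
    (hhar : ∀ h : Euc d → ℝ, HarmOn h O → ∫ x, h x ∂β = ∫ x, h x ∂δ)
    {V : Set (Euc d)} (hV : IsOpen V) (hin : infill O (msupp β ∪ msupp δ) ⊆ V)
    {h : Euc d → ℝ} (hh : HarmOn h V) : ∫ x, h x ∂β = ∫ x, h x ∂δ := by
  have := hβ.isFiniteMeasure
  have := hδ.isFiniteMeasure
  have hβS : ∀ᵐ x ∂β, x ∈ msupp β ∪ msupp δ := hβ.ae_mem_msupp.mono fun x hx => Or.inl hx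
  have hδS : ∀ᵐ x ∂δ, x ∈ msupp β ∪ msupp δ := hδ.ae_mem_msupp.mono fun x hx => Or.inr hx
  obtain ⟨K, hK, hSK, hKin, hpot⟩ := exists_isCompact_potential_eq hd (hβ.1.union hδ.1) hβS hδS
    (union_subset hβ.2.1 hδ.2.1) hhar
  have hβK : ∀ᵐ x ∂β, x ∈ K := hβS.mono fun x hx => hSK hx
  have hδK : ∀ᵐ x ∂δ, x ∈ K := hδS.mono fun x hx => hSK hx
  rcases K.eq_empty_or_nonempty with rfl | hKne
  · have hβ0 : β = 0 := ae_eq_bot.1 (eventually_false_iff_eq_bot.1 hβK)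
    have hδ0 : δ = 0 := ae_eq_bot.1 (eventually_false_iff_eq_bot.1 hδK)
    rw [hβ0, hδ0]
  · refine integral_eq_of_potential_eq hd hK hKne hV (hKin.trans hin) hβK hδK ?_ hpot hh
    simpa using hhar _ (harmOn_const 1 O)

lemma SbhOn.eq_bot_of_dim_zero {u : Euc 0 → EReal} {O : Set (Euc 0)} (hu : SbhOn u O)
    (hO : O.Nonempty) (x : Euc 0) : u x = ⊥ := by
  have huniv : O = univ := Subsingleton.eq_univ_of_nonempty hO
  refine EReal.eq_bot_iff_forall_lt _ |>.2 fun c => ?_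
  refine lt_of_le_of_lt (hu.2.2 x 1 one_pos (by simp [huniv]) (fun _ => c - 1) continuousOn_const
    (harmOn_const _ _) (fun y hy => ?_) x (mem_closedBall_self zero_le_one))
    (EReal.coe_lt_coe_iff.2 (sub_one_lt c))
  rw [mem_sphere, Subsingleton.elim y x, dist_self] at hy
  exact absurd hy zero_ne_one

/-- Let `β, δ, ω` be finite positive Borel measures with compact support in
the open set `O ⊆ ℝ^d` with `β ⪯_{har(O)} δ` and `β ⪯_{sbh(O)} ω`. If there is an open set
`O'` relatively compact in `O` with `infill O (supp β ∪ supp δ) ⊆ O'` and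
`O' ∩ supp ω = ∅`, then `δ ⪯_{sbh(O)} ω`. -/
theorem stmt_17 {d : ℕ} (O : Set (Euc d)) (hO : IsOpen O) (hOne : O.Nonempty)
    (β δ ω : Measure (Euc d))
    (hβ : MeasCompIn β O) (hδ : MeasCompIn δ O) (hω : MeasCompIn ω O)
    (hhar : ∀ h : Euc d → ℝ, HarmOn h O → ∫ x, h x ∂β = ∫ x, h x ∂δ)
    (hsbh : ∀ u : Euc d → EReal, SbhOn u O → eInt β u ≤ eInt ω u)
    (O' : Set (Euc d)) (hO' : IsOpen O')
    (hO'c : IsCompact (closure O') ∧ closure O' ⊆ O)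
    (hin : infill O (msupp β ∪ msupp δ) ⊆ O')
    (hdisj : O' ∩ msupp ω = ∅) :
    ∀ u : Euc d → EReal, SbhOn u O → eInt δ u ≤ eInt ω u := by
  intro u hu
  have := hβ.isFiniteMeasure
  have := hδ.isFiniteMeasure
  rcases Nat.eq_zero_or_pos d with rfl | hd
  · have hmass : β univ = δ univ := by
      have h1 : β.real univ = δ.real univ := by simpa using hhar _ (harmOn_const 1 O)
      exact (measureReal_eq_measureReal_iff).1 h1
    have heq : eInt δ u = eInt β u := by
      simp only [eInt, hu.eq_bot_of_dim_zero hOne, lintegral_const, hmass]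
    exact heq.trans_le (hsbh u hu)
  have hmem : ∀ {μ : Measure (Euc d)}, MeasCompIn μ O → msupp μ ⊆ msupp β ∪ msupp δ →
      μ O'ᶜ = 0 := fun hμ hsub =>
    measure_mono_null (compl_subset_compl.2 (hsub.trans (subset_union_left.trans hin))) hμ.2.2.1
  have hωO' : ω O' = 0 := measure_mono_null
    (disjoint_iff_inter_eq_empty.2 hdisj).subset_compl_right hω.2.2.1
  have hreal : ∀ v, SubharmOn v O → Measurable v → (∃ L, ∀ x, L ≤ v x) →
      ∫ x, v x ∂β ≤ ∫ x, v x ∂ω := fun v hv hvm ⟨L, hL⟩ => by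
    have := hsbh _ hv.sbhOn
    rwa [eInt_coe (hv.integrable hvm hL hβ), eInt_coe (hv.integrable hvm hL hω),
      EReal.coe_le_coe_iff] at this
  choose v hv hvm hvL hvu using fun N : ℕ => hu.exists_truncation hd hO (N : ℝ)
  refine le_eInt_of_le_eInt_truncation (hω.ae_mem_msupp.mono fun x hx => hω.2.1 hx) hvm hvu
    ((hv 0).integrable (hvm 0) (hvL 0) hω) fun N => ?_
  calc eInt δ u ≤ eInt δ fun x => (v N x : EReal) := by
        refine eInt_mono (hδ.ae_mem_msupp.mono fun x hx => ?_)
        rw [hvu N x (hδ.2.1 hx)]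
        exact le_max_left _ _
    _ ≤ eInt ω fun x => (v N x : EReal) := by
        rw [eInt_coe ((hv N).integrable (hvm N) (hvL N) hδ),
          eInt_coe ((hv N).integrable (hvm N) (hvL N) hω), EReal.coe_le_coe_iff]
        exact SubharmOn.integral_le hd hO' hO'c.1 hO'c.2 (hmem hβ subset_union_left)
          (hmem hδ subset_union_right) hωO'
          (fun h hh => integral_eq_of_infill_subset hd hβ hδ hhar hO' hin hh) hreal (hv N)
          (hvm N) (hvL N)
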